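/- arXiv:1303.6332 — 18 statements merged into one kernel-verified Lean document; each statement's English description precedes it below -/
import Mathlib

section
/- Let U be a set and let (F, G) be a Galois connection on the power set lattice ℘(U) ordered by inclusion (i.e., F, G : ℘(U) → ℘(U) with F(A) ⊆ B ⟺ A ⊆ G(B) for all A, B ⊆ U). Then there exists a tolerance R on U such that F(X) = X^△ and G(X) = X^▽ for all X ⊆ U if and only if the following two conditions hold for all x, y ∈ U: (i) x ∈ F({x}); (ii) x ∈ F({y}) implies y ∈ F({x}). -/
open Set

universe u v

def Tolerance {U : Type*} (R : U → U → Prop) : Prop := Reflexive R ∧ Symmetric R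

def tolNbhd {U : Type*} (R : U → U → Prop) (x : U) : Set U := {y | R x y}

def lowerApprox {U : Type*} (R : U → U → Prop) (X : Set U) : Set U :=
  {x | tolNbhd R x ⊆ X}

def upperApprox {U : Type*} (R : U → U → Prop) (X : Set U) : Set U :=
  {x | (tolNbhd R x ∩ X).Nonempty}

def RSpairs {U : Type*} (R : U → U → Prop) : Set (Set U × Set U) :=
  {p | ∃ X : Set U, p = (lowerApprox R X, upperApprox R X)}

def IsPreblock {U : Type*} (R : U → U → Prop) (B : Set U) : Prop :=
  ∀ x ∈ B, ∀ y ∈ B, R x y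

def IsBlock {U : Type*} (R : U → U → Prop) (B : Set U) : Prop :=
  IsPreblock R B ∧ ∀ C : Set U, IsPreblock R C → B ⊆ C → B = C

def IsCovering {U : Type*} (H : Set (Set U)) : Prop :=
  (∀ X ∈ H, X.Nonempty) ∧ ⋃₀ H = Set.univ

def IsIrredundantCovering {U : Type*} (H : Set (Set U)) : Prop :=
  IsCovering H ∧ ∀ X ∈ H, ¬ IsCovering (H \ {X})

def InducedBy {U : Type*} (R : U → U → Prop) (H : Set (Set U)) : Prop :=
  ∀ x y : U, R x y ↔ ∃ B ∈ H, x ∈ B ∧ y ∈ B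

def singl {U : Type*} (R : U → U → Prop) : Set U := {x | tolNbhd R x = {x}}

def pol {U : Type*} (R : U → U → Prop) (A : Set U) : Set U := {y | ∀ x ∈ A, ¬ R x y}

def Concepts {U : Type*} (R : U → U → Prop) : Set (Set U × (Set U)ᵒᵈ) :=
  {p | pol R p.1 = OrderDual.ofDual p.2 ∧ pol R (OrderDual.ofDual p.2) = p.1}

def restrictRel {U : Type*} (R : U → U → Prop) (X : Set U) : ↥X → ↥X → Prop :=
  fun a b => R a b

def CondC {U : Type*} (R : U → U → Prop) : Prop :=
  ∀ a : Fin 5 → U, Function.Injective a →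
    (∀ i : Fin 4, R (a i.castSucc) (a i.succ)) →
    ∃ i j : Fin 5, ((i : ℕ) + 2 ≤ (j : ℕ) ∨ (j : ℕ) + 2 ≤ (i : ℕ)) ∧ R (a i) (a j)

theorem stmt_0 {U : Type*} (F G : Set U → Set U)
    (hFG : ∀ A B : Set U, F A ⊆ B ↔ A ⊆ G B) :
    (∃ R : U → U → Prop, Tolerance R ∧
        (∀ X : Set U, F X = upperApprox R X) ∧ (∀ X : Set U, G X = lowerApprox R X)) ↔
      ((∀ x : U, x ∈ F {x}) ∧ (∀ x y : U, x ∈ F {y} → y ∈ F {x})) := by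
  constructor
  · rintro ⟨R, ⟨hr, hs⟩, hF, -⟩
    have key : ∀ x y : U, x ∈ F {y} ↔ R x y := by
      intro x y
      rw [hF]
      constructor
      · rintro ⟨z, hz, hzy⟩
        have hzy' : z = y := hzy
        subst hzy'
        exact hz
      · intro h
        exact ⟨y, h, rfl⟩
    refine ⟨fun x => (key x x).2 (hr x), fun x y h => (key y x).2 (hs ((key x y).1 h))⟩
  · rintro ⟨h1, h2⟩
    have hmono : ∀ A B : Set U, A ⊆ B → F A ⊆ F B := fun A B h =>
      (hFG A (F B)).2 (h.trans ((hFG B (F B)).1 (Subset.refl _)))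
    refine ⟨fun x y => x ∈ F {y}, ⟨fun x => h1 x, fun x y h => h2 x y h⟩, ?_, ?_⟩
    · intro X
      apply Subset.antisymm
      · rw [hFG]
        intro x hx
        have h : F {x} ⊆ upperApprox (fun x y => x ∈ F {y}) X := fun z hz => ⟨x, hz, hx⟩
        exact (hFG _ _).1 h rfl
      · rintro x ⟨y, hxy, hy⟩
        exact hmono {y} X (singleton_subset_iff.2 hy) hxy
    · intro X
      ext x
      rw [← singleton_subset_iff, ← hFG]
      exact ⟨fun h y hy => h (h2 x y hy), fun h y hy => h (h2 y x hy)⟩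
end

section
/- Let R be a tolerance on a set U and let 𝕂 be the formal context (U, U, Rᶜ), where Rᶜ is the complement of R. Then the complete lattices ℘(U)^△ (all upper approximations ordered by inclusion), ℘(U)^▽ (all lower approximations ordered by inclusion), and the concept lattice 𝔅(𝕂) are pairwise order-isomorphic. -/
open Set

universe u v

theorem upper_lower_gc {U : Type*} {R : U → U → Prop} (hR : Tolerance R) :
    GaloisConnection (upperApprox R) (lowerApprox R) := by
  intro X Y
  constructor
  · intro h x hx y hy
    exact h ⟨x, hR.2 hy, hx⟩
  · rintro h x ⟨y, hxy, hy⟩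
    exact h hy (hR.2 hxy)

theorem pol_eq_compl_upper {U : Type*} {R : U → U → Prop} (hR : Tolerance R) (A : Set U) :
    pol R A = (upperApprox R A)ᶜ := by
  ext y
  constructor
  · rintro h ⟨x, hyx, hx⟩
    exact h x hx (hR.2 hyx)
  · intro h x hx hxy
    exact h ⟨x, hR.2 hxy, hx⟩

theorem pol_compl {U : Type*} {R : U → U → Prop} (hR : Tolerance R) (A : Set U) :
    pol R Aᶜ = lowerApprox R A := by
  ext y
  constructor
  · intro h x hyx
    by_contra hx
    exact h x hx (hR.2 hyx)
  · intro h x hx hxy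
    exact hx (h (hR.2 hxy))

def upperIsoLower {U : Type*} {R : U → U → Prop} (hR : Tolerance R) :
    ↥(Set.range (upperApprox R)) ≃o ↥(Set.range (lowerApprox R)) where
  toFun X := ⟨lowerApprox R X.1, X.1, rfl⟩
  invFun X := ⟨upperApprox R X.1, X.1, rfl⟩
  left_inv := by
    rintro ⟨_, X, rfl⟩
    exact Subtype.ext ((upper_lower_gc hR).l_u_l_eq_l X)
  right_inv := by
    rintro ⟨_, X, rfl⟩
    exact Subtype.ext ((upper_lower_gc hR).u_l_u_eq_u X)
  map_rel_iff' := by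
    rintro ⟨_, X, rfl⟩ ⟨_, Y, rfl⟩
    constructor
    · intro h
      have h' := (upper_lower_gc hR).monotone_l h
      change upperApprox R (lowerApprox R (upperApprox R X)) ≤
        upperApprox R (lowerApprox R (upperApprox R Y)) at h'
      rwa [(upper_lower_gc hR).l_u_l_eq_l, (upper_lower_gc hR).l_u_l_eq_l] at h'
    · intro h
      exact (upper_lower_gc hR).monotone_u h

def lowerIsoConcepts {U : Type*} {R : U → U → Prop} (hR : Tolerance R) :
    ↥(Set.range (lowerApprox R)) ≃o ↥(Concepts R) where
  toFun X := ⟨(X.1, OrderDual.toDual (pol R X.1)), rfl, by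
    obtain ⟨_, X, rfl⟩ := X
    change pol R (pol R (lowerApprox R X)) = lowerApprox R X
    rw [pol_eq_compl_upper hR (lowerApprox R X), pol_compl hR]
    exact (upper_lower_gc hR).u_l_u_eq_u X⟩
  invFun p := ⟨p.1.1, (OrderDual.ofDual p.1.2)ᶜ, by
    rw [← pol_compl hR, compl_compl]
    exact p.2.2⟩
  left_inv := fun X => rfl
  right_inv := by
    rintro ⟨⟨A, B⟩, h1, h2⟩
    exact Subtype.ext (Prod.ext rfl h1)
  map_rel_iff' := by
    intro X Y
    constructor
    · intro h
      exact h.1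
    · intro h
      refine ⟨h, ?_⟩
      intro y hy x hx
      exact hy x (h hx)

theorem stmt_1 {U : Type*} (R : U → U → Prop) (hR : Tolerance R) :
    Nonempty (↥(Set.range (upperApprox R)) ≃o ↥(Set.range (lowerApprox R))) ∧
    Nonempty (↥(Set.range (upperApprox R)) ≃o ↥(Concepts R)) ∧
    Nonempty (↥(Set.range (lowerApprox R)) ≃o ↥(Concepts R)) := by
  exact ⟨⟨upperIsoLower hR⟩, ⟨(upperIsoLower hR).trans (lowerIsoConcepts hR)⟩,
    ⟨lowerIsoConcepts hR⟩⟩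
end

section
/- Let R be a tolerance on a set U and 𝕂 = (U, U, Rᶜ). Then the concept lattice 𝔅(𝕂), identified with {(A, A^⊤) | A ∈ ℘(U)^▽} where A^⊤ = A^{c▽}, is a complete sublattice of the product of the complete lattice ℘(U)^▽ with the order-dual of ℘(U)^▽: for any family {(A_j, B_j)}_{j∈J} ⊆ 𝔅(𝕂), its join and meet computed in 𝔅(𝕂) coincide with those computed in ℘(U)^▽ × (℘(U)^▽)^op, namely ⋁_j (A_j,B_j) = ((⋃_j A_j)^{△▽}, ⋂_j B_j) and ⋀_j (A_j,B_j) = (⋂_j A_j, (⋃_j B_j)^{△▽}). -/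
open Set

universe u v

theorem pol_anti_aux {U : Type*} (R : U → U → Prop) {A B : Set U} (h : A ⊆ B) :
    pol R B ⊆ pol R A := fun _ hy x hx => hy x (h hx)

theorem sub_pol_pol_aux {U : Type*} (R : U → U → Prop) (hs : Symmetric R) (A : Set U) :
    A ⊆ pol R (pol R A) := fun _ hx _ hy hr => hy _ hx (hs hr)

theorem pol3_aux {U : Type*} (R : U → U → Prop) (hs : Symmetric R) (A : Set U) :
    pol R (pol R (pol R A)) = pol R A :=
  Set.Subset.antisymm (pol_anti_aux R (sub_pol_pol_aux R hs A)) (sub_pol_pol_aux R hs _)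

theorem lower_upper_aux {U : Type*} (R : U → U → Prop) (hs : Symmetric R) (A : Set U) :
    lowerApprox R (upperApprox R A) = pol R (pol R A) := by
  ext x
  constructor
  · intro h y hy hr
    obtain ⟨z, hz, hzA⟩ := h (show y ∈ tolNbhd R x from hs hr)
    exact hy z hzA (hs hz)
  · intro h y hy
    by_contra hn
    exact h y (fun z hz hr => hn ⟨z, hs hr, hz⟩) (hs hy)

theorem lower_aux {U : Type*} (R : U → U → Prop) (hs : Symmetric R) (A : Set U) :
    lowerApprox R A = pol R Aᶜ := by
  ext x
  constructor
  · intro h y hy hr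
    exact hy (h (show y ∈ tolNbhd R x from hs hr))
  · intro h y hy
    by_contra hn
    exact h y hn (hs hy)

theorem pol_iUnion_aux {U : Type*} (R : U → U → Prop) {J : Type*} (A : J → Set U) :
    pol R (⋃ j, A j) = ⋂ j, pol R (A j) := by
  ext y
  simp only [pol, Set.mem_iUnion, Set.mem_iInter, Set.mem_setOf_eq]
  exact ⟨fun h j x hx => h x ⟨j, hx⟩, fun h x ⟨j, hx⟩ => h j x hx⟩

theorem closed_aux {U : Type*} (R : U → U → Prop) (hs : Symmetric R) {A B : Set U}
    (hB : B ∈ Set.range (lowerApprox R)) (h : A ⊆ B) :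
    lowerApprox R (upperApprox R A) ⊆ B := by
  obtain ⟨X, rfl⟩ := hB
  rw [lower_upper_aux R hs, lower_aux R hs X, ← pol3_aux R hs Xᶜ, ← lower_aux R hs X]
  exact pol_anti_aux R (pol_anti_aux R h)

theorem pol_range_aux {U : Type*} (R : U → U → Prop) (hs : Symmetric R) (A : Set U) :
    pol R A ∈ Set.range (lowerApprox R) :=
  ⟨Aᶜ, by rw [lower_aux R hs, compl_compl]⟩

theorem stmt_2 {U : Type*} (R : U → U → Prop) (hR : Tolerance R)
    {J : Type*} (f : J → Set U × (Set U)ᵒᵈ) (hf : ∀ j, f j ∈ Concepts R) :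
    ∀ supPair infPair : Set U × (Set U)ᵒᵈ,
      supPair = (lowerApprox R (upperApprox R (⋃ j, (f j).1)),
        OrderDual.toDual (⋂ j, OrderDual.ofDual (f j).2)) →
      infPair = (⋂ j, (f j).1,
        OrderDual.toDual (lowerApprox R (upperApprox R (⋃ j, OrderDual.ofDual (f j).2)))) →
      supPair ∈ Concepts R ∧ infPair ∈ Concepts R ∧
      supPair ∈ upperBounds (Set.range f) ∧
      (∀ q ∈ Concepts R, q ∈ upperBounds (Set.range f) → supPair ≤ q) ∧
      (∀ q : Set U × (Set U)ᵒᵈ, q.1 ∈ Set.range (lowerApprox R) →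
        OrderDual.ofDual q.2 ∈ Set.range (lowerApprox R) →
        q ∈ upperBounds (Set.range f) → supPair ≤ q) ∧
      infPair ∈ lowerBounds (Set.range f) ∧
      (∀ q ∈ Concepts R, q ∈ lowerBounds (Set.range f) → q ≤ infPair) ∧
      (∀ q : Set U × (Set U)ᵒᵈ, q.1 ∈ Set.range (lowerApprox R) →
        OrderDual.ofDual q.2 ∈ Set.range (lowerApprox R) →
        q ∈ lowerBounds (Set.range f) → q ≤ infPair) := by
  rintro _ _ rfl rfl
  have hs := hR.2
  have h1 : ∀ j, pol R (f j).1 = OrderDual.ofDual (f j).2 := fun j => (hf j).1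
  have h2 : ∀ j, pol R (OrderDual.ofDual (f j).2) = (f j).1 := fun j => (hf j).2
  have e1 : (⋂ j, OrderDual.ofDual (f j).2) = pol R (⋃ j, (f j).1) := by
    rw [pol_iUnion_aux]; simp only [h1]
  have e2 : (⋂ j, (f j).1) = pol R (⋃ j, OrderDual.ofDual (f j).2) := by
    rw [pol_iUnion_aux]; simp only [h2]
  have hsup : ∀ q : Set U × (Set U)ᵒᵈ, q.1 ∈ Set.range (lowerApprox R) →
        OrderDual.ofDual q.2 ∈ Set.range (lowerApprox R) →
        q ∈ upperBounds (Set.range f) →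
        (lowerApprox R (upperApprox R (⋃ j, (f j).1)),
        OrderDual.toDual (⋂ j, OrderDual.ofDual (f j).2)) ≤ q := by
    intro q hq1 _ hq
    have hj : ∀ j, f j ≤ q := fun j => hq ⟨j, rfl⟩
    refine ⟨closed_aux R hs hq1 (Set.iUnion_subset fun j => (hj j).1), ?_⟩
    have hI : OrderDual.ofDual q.2 ⊆ ⋂ j, OrderDual.ofDual (f j).2 :=
      Set.subset_iInter fun j => OrderDual.ofDual_le_ofDual.2 (hj j).2
    exact hI
  have hinf : ∀ q : Set U × (Set U)ᵒᵈ, q.1 ∈ Set.range (lowerApprox R) →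
        OrderDual.ofDual q.2 ∈ Set.range (lowerApprox R) →
        q ∈ lowerBounds (Set.range f) → q ≤ (⋂ j, (f j).1,
        OrderDual.toDual (lowerApprox R (upperApprox R (⋃ j, OrderDual.ofDual (f j).2)))) := by
    intro q _ hq2 hq
    have hj : ∀ j, q ≤ f j := fun j => hq ⟨j, rfl⟩
    refine ⟨Set.subset_iInter fun j => (hj j).1, ?_⟩
    have hU : (⋃ j, OrderDual.ofDual (f j).2) ⊆ OrderDual.ofDual q.2 :=
      Set.iUnion_subset fun j => OrderDual.ofDual_le_ofDual.2 (hj j).2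
    exact closed_aux R hs hq2 hU
  have hc : ∀ q ∈ Concepts R, q.1 ∈ Set.range (lowerApprox R) ∧
      OrderDual.ofDual q.2 ∈ Set.range (lowerApprox R) := by
    intro q hq
    exact ⟨hq.2 ▸ pol_range_aux R hs _, hq.1 ▸ pol_range_aux R hs _⟩
  refine ⟨?_, ?_, ?_, fun q hq => hsup q (hc q hq).1 (hc q hq).2, hsup, ?_,
    fun q hq => hinf q (hc q hq).1 (hc q hq).2, hinf⟩
  · rw [e1, lower_upper_aux R hs]
    exact ⟨pol3_aux R hs _, rfl⟩
  · rw [e2, lower_upper_aux R hs]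
    exact ⟨rfl, pol3_aux R hs _⟩
  · rintro _ ⟨j, rfl⟩
    rw [lower_upper_aux R hs]
    exact ⟨(Set.subset_iUnion (fun j => (f j).1) j).trans (sub_pol_pol_aux R hs _),
      Set.iInter_subset (fun j => OrderDual.ofDual (f j).2) j⟩
  · rintro _ ⟨j, rfl⟩
    rw [lower_upper_aux R hs]
    exact ⟨Set.iInter_subset (fun j => (f j).1) j,
      (Set.subset_iUnion (fun j => OrderDual.ofDual (f j).2) j).trans (sub_pol_pol_aux R hs _)⟩
end

section
/- A complete lattice L admits an orthocomplementation (and hence forms an ortholattice) if and only if there exist a set U and a tolerance R on U such that L is order-isomorphic to the complete lattice ℘(U)^▽ of lower approximations (equivalently, to ℘(U)^△). -/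
open Set

universe u v

theorem lower_closed {U : Type*} {R : U → U → Prop} (hs : Symmetric R) (X : Set U) :
    lowerApprox R ((lowerApprox R ((lowerApprox R X)ᶜ))ᶜ) = lowerApprox R X := by
  ext x
  simp only [lowerApprox, tolNbhd, Set.mem_setOf_eq, Set.subset_def, Set.mem_compl_iff]
  constructor
  · intro h y hy
    by_contra hX
    exact h y hy (fun z hz hz2 => hX (hz2 y (hs hz)))
  · intro h y hy h2
    exact h2 x (hs hy) h

theorem lower_anti {U : Type*} {R : U → U → Prop} {X Y : Set U} (h : X ⊆ Y) :
    lowerApprox R Yᶜ ⊆ lowerApprox R Xᶜ :=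
  fun _ hx => hx.trans (Set.compl_subset_compl.2 h)

theorem stmt_3 {L : Type u} [CompleteLattice L] :
    (∃ c : L → L,
        (∀ x y : L, x ≤ y → c y ≤ c x) ∧
        (∀ x : L, c (c x) = x) ∧
        (∀ x : L, x ⊔ c x = ⊤) ∧ (∀ x : L, x ⊓ c x = ⊥)) ↔
      ∃ (V : Type u) (R : V → V → Prop), Tolerance R ∧
        Nonempty (L ≃o ↥(Set.range (lowerApprox R))) ∧
        Nonempty (L ≃o ↥(Set.range (upperApprox R))) := by
  constructor
  · rintro ⟨c, anti, inv, -, hinf⟩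
    have swap : ∀ x y : L, x ≤ c y → y ≤ c x := fun x y h => by
      have := anti _ _ h
      rwa [inv] at this
    have le_of : ∀ a b : L, (∀ x : {x : L // x ≠ ⊥}, x.1 ≤ a → x.1 ≤ b) → a ≤ b := by
      intro a b h
      by_cases ha : a = ⊥
      · simp [ha]
      · exact h ⟨a, ha⟩ le_rfl
    let R : {x : L // x ≠ ⊥} → {x : L // x ≠ ⊥} → Prop := fun x y => ¬ x.1 ≤ c y.1
    have hl : ∀ a : L, lowerApprox R {y | ¬ y.1 ≤ c a} = {x | x.1 ≤ a} := by
      intro a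
      ext x
      simp only [lowerApprox, tolNbhd, Set.mem_setOf_eq, Set.subset_def, R]
      constructor
      · intro h
        have h1 : c a ≤ c x.1 := le_of _ _ fun y hy => by
          by_contra h2
          exact h y (fun h3 => h2 (swap _ _ h3)) hy
        have := anti _ _ h1
        rwa [inv, inv] at this
      · intro h y hy h2
        exact hy (h.trans (swap _ _ h2))
    have hu : ∀ a : L, upperApprox R {y | y.1 ≤ a} = {x | ¬ x.1 ≤ c a} := by
      intro a
      ext x
      simp only [upperApprox, tolNbhd, Set.mem_setOf_eq, Set.Nonempty, Set.mem_inter_iff, R]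
      constructor
      · rintro ⟨y, h1, h2⟩ h3
        exact h1 (h3.trans (anti _ _ h2))
      · intro h
        by_contra h2
        push Not at h2
        refine h (swap _ _ (le_of _ _ fun y hy => ?_))
        by_contra h3
        exact h2 y (fun h4 => h3 (swap _ _ h4)) hy
    refine ⟨{x : L // x ≠ ⊥}, R, ⟨?_, ?_⟩, ⟨?_⟩, ⟨?_⟩⟩
    · intro x h
      apply x.2
      have := hinf x.1
      rwa [inf_eq_left.2 h] at this
    · intro x y h h2
      exact h (swap _ _ h2)
    · let f : L ↪o ↥(Set.range (lowerApprox R)) := OrderEmbedding.ofMapLEIff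
        (fun a => ⟨{x | x.1 ≤ a}, _, hl a⟩) (fun a b => by
          constructor
          · intro h
            exact le_of _ _ fun x hx => h hx
          · intro h x hx
            exact le_trans hx h)
      refine RelIso.ofSurjective f ?_
      rintro ⟨_, X, rfl⟩
      refine ⟨⨅ y : {y : {x : L // x ≠ ⊥} // y ∉ X}, c y.1.1, Subtype.ext ?_⟩
      change {x : {x : L // x ≠ ⊥} | x.1 ≤ ⨅ y : {y : {x : L // x ≠ ⊥} // y ∉ X}, c y.1.1} = _
      ext x
      simp only [lowerApprox, tolNbhd, Set.mem_setOf_eq, Set.subset_def, R, le_iInf_iff]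
      constructor
      · intro h y hy
        by_contra hX
        exact hy (h ⟨y, hX⟩)
      · intro h y
        by_contra hX
        exact y.2 (h _ hX)
    · let f : L ↪o ↥(Set.range (upperApprox R)) := OrderEmbedding.ofMapLEIff
        (fun a => ⟨{x | ¬ x.1 ≤ c a}, _, hu a⟩) (fun a b => by
          constructor
          · intro h
            have h1 : c b ≤ c a := le_of _ _ fun x hx => by
              by_contra h2
              exact h (a := x) h2 hx
            have := anti _ _ h1
            rwa [inv, inv] at this
          · intro h x hx h2
            exact hx (le_trans h2 (anti _ _ h)))
      refine RelIso.ofSurjective f ?_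
      rintro ⟨_, X, rfl⟩
      refine ⟨c (⨅ y : X, c y.1.1), Subtype.ext ?_⟩
      change {x : {x : L // x ≠ ⊥} | ¬ x.1 ≤ c (c (⨅ y : X, c y.1.1))} = _
      ext x
      simp only [upperApprox, tolNbhd, Set.mem_setOf_eq, Set.Nonempty, Set.mem_inter_iff, R,
        inv, le_iInf_iff, not_forall]
      constructor
      · rintro ⟨y, hy⟩
        exact ⟨y.1, hy, y.2⟩
      · rintro ⟨y, hy, hX⟩
        exact ⟨⟨y, hX⟩, hy⟩
  · rintro ⟨V, R, ⟨hr, hs⟩, ⟨e⟩, -⟩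
    let k : ↥(Set.range (lowerApprox R)) → ↥(Set.range (lowerApprox R)) :=
      fun A => ⟨lowerApprox R A.1ᶜ, _, rfl⟩
    have kinv : ∀ A, k (k A) = A := by
      rintro ⟨_, X, rfl⟩
      exact Subtype.ext (lower_closed hs X)
    have kanti : ∀ A B, A ≤ B → k B ≤ k A := fun A B h => lower_anti h
    let c : L → L := fun x => e.symm (k (e x))
    have anti : ∀ x y : L, x ≤ y → c y ≤ c x := fun x y h =>
      e.symm.monotone (kanti _ _ (e.monotone h))
    have inv : ∀ x : L, c (c x) = x := fun x => by simp [c, kinv]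
    have hinf : ∀ x : L, x ⊓ c x = ⊥ := by
      intro x
      have h1 : e (x ⊓ c x) ≤ e x := e.monotone inf_le_left
      have h2 : e (x ⊓ c x) ≤ k (e x) := by
        have := e.monotone (inf_le_right : x ⊓ c x ≤ c x)
        simpa only [c, OrderIso.apply_symm_apply] using this
      have h3 : e (x ⊓ c x) ≤ e ⊥ := by
        intro v hv
        exact absurd (h1 hv) (h2 hv (hr v))
      exact le_bot_iff.1 (e.le_iff_le.1 h3)
    refine ⟨c, anti, inv, fun x => ?_, hinf⟩
    have h1 : c (x ⊔ c x) = ⊥ := by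
      rw [← le_bot_iff, ← hinf x]
      refine le_inf ?_ (anti _ _ le_sup_left)
      have := anti _ _ (le_sup_right : c x ≤ x ⊔ c x)
      rwa [inv] at this
    have h2 : c ⊥ = ⊤ := by
      rw [← top_le_iff]
      have := anti _ _ (bot_le : ⊥ ≤ c ⊤)
      rwa [inv] at this
    rw [← inv (x ⊔ c x), h1, h2]
end

section
/- Let R be a tolerance on a set U. The following are equivalent: (a) for any a R b there exist c, d ∈ U with a R c and b R d such that for all k ∈ R(c) one has R(d) ⊆ R(k); (b) for any a R b there exists d ∈ U with R(d) ⊆ R(a) ∩ R(b) such that for all x with x R d one has R(d) ⊆ R(x); (c) for any a R b there exist a block B of R and an element d ∈ B such that a, b ∈ R(d) = B; (d) R is the tolerance induced by some irredundant covering of U. -/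
open Set

universe u v

theorem stmt_4 {U : Type*} (R : U → U → Prop) (hR : Tolerance R) :
    List.TFAE
      [ ∀ a b : U, R a b → ∃ c d : U, R a c ∧ R b d ∧
          ∀ k ∈ tolNbhd R c, tolNbhd R d ⊆ tolNbhd R k,
        ∀ a b : U, R a b → ∃ d : U, tolNbhd R d ⊆ tolNbhd R a ∩ tolNbhd R b ∧
          ∀ x : U, R x d → tolNbhd R d ⊆ tolNbhd R x,
        ∀ a b : U, R a b → ∃ B : Set U, IsBlock R B ∧
          ∃ d ∈ B, tolNbhd R d = B ∧ a ∈ tolNbhd R d ∧ b ∈ tolNbhd R d,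
        ∃ H : Set (Set U), IsIrredundantCovering H ∧ InducedBy R H ] := by
  obtain ⟨hr, hs⟩ := hR
  have hr' : ∀ x, R x x := fun x => hr x
  have hs' : ∀ x y, R x y → R y x := fun x y h => hs h
  have key : ∀ d : U, IsPreblock R (tolNbhd R d) → IsBlock R (tolNbhd R d) := by
    intro d hd
    refine ⟨hd, fun C hC hsub => Set.Subset.antisymm hsub ?_⟩
    intro y hy
    exact hC d (hsub (hr' d)) y hy
  tfae_have 1 → 2 := by
    intro h a b hab
    obtain ⟨c, d, hac, hbd, hk⟩ := h a b hab
    have hk' : ∀ k y, R c k → R d y → R k y := fun k y h1 h2 => hk k h1 h2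
    have hcd : ∀ y, R c y → R d y := fun y hy => hs' _ _ (hk' y d hy (hr' d))
    have hdc : ∀ y, R d y → R c y := fun y hy => hk' c y (hr' c) hy
    refine ⟨d, fun y hy => ⟨hk' a y (hs' _ _ hac) hy, hk' b y (hdc b (hs' _ _ hbd)) hy⟩, ?_⟩
    intro x hx y hy
    exact hk' x y (hdc x (hs' _ _ hx)) hy
  tfae_have 2 → 3 := by
    intro h a b hab
    obtain ⟨d, hd, hx⟩ := h a b hab
    refine ⟨tolNbhd R d, key d ?_, d, hr' d, rfl, hs' _ _ (hd (hr' d)).1, hs' _ _ (hd (hr' d)).2⟩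
    intro x hxd y hy
    exact hx x (hs' _ _ hxd) hy
  tfae_have 3 → 1 := by
    intro h a b hab
    obtain ⟨B, hB, d, hdB, rfl, ha, hb⟩ := h a b hab
    exact ⟨d, d, hs' _ _ ha, hs' _ _ hb, fun k hk y hy => hB.1 k hk y hy⟩
  tfae_have 3 → 4 := by
    intro h
    refine ⟨{X | ∃ d, X = tolNbhd R d ∧ IsPreblock R X}, ⟨⟨?_, ?_⟩, ?_⟩, ?_⟩
    · rintro X ⟨d, rfl, -⟩
      exact ⟨d, hr' d⟩
    · refine Set.eq_univ_of_forall fun x => ?_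
      obtain ⟨B, hB, d, hdB, rfl, ha, hb⟩ := h x x (hr' x)
      exact ⟨_, ⟨d, rfl, hB.1⟩, ha⟩
    · rintro X ⟨d, rfl, hd⟩ ⟨-, hcov⟩
      have : d ∈ (Set.univ : Set U) := trivial
      rw [← hcov] at this
      obtain ⟨Y, ⟨⟨e, rfl, he⟩, hne⟩, hdY⟩ := this
      apply hne
      refine Set.Subset.antisymm (fun y hy => he d hdY y hy) (fun y hy => ?_)
      exact hd e (hs' _ _ hdY) y hy
    · intro x y
      constructor
      · intro hxy
        obtain ⟨B, hB, d, hdB, rfl, ha, hb⟩ := h x y hxy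
        exact ⟨_, ⟨d, rfl, hB.1⟩, ha, hb⟩
      · rintro ⟨B, ⟨d, -, hB⟩, hx, hy⟩
        exact hB x hx y hy
  tfae_have 4 → 3 := by
    rintro ⟨H, ⟨⟨hne, hcov⟩, hirr⟩, hind⟩ a b hab
    obtain ⟨B, hB, ha, hb⟩ := (hind a b).1 hab
    have hd : ∃ d, ∀ X ∈ H, d ∈ X → X = B := by
      by_contra hcon
      push Not at hcon
      refine hirr B hB ⟨fun X hX => hne X hX.1, Set.eq_univ_of_forall fun x => ?_⟩
      obtain ⟨X, hX, hxX, hXB⟩ := hcon x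
      exact ⟨X, ⟨hX, hXB⟩, hxX⟩
    obtain ⟨d, hd⟩ := hd
    have hdB : d ∈ B := by
      have : d ∈ (Set.univ : Set U) := trivial
      rw [← hcov] at this
      obtain ⟨X, hX, hdX⟩ := this
      exact hd X hX hdX ▸ hdX
    have heq : tolNbhd R d = B := by
      ext y
      constructor
      · intro hy
        obtain ⟨X, hX, hdX, hyX⟩ := (hind d y).1 hy
        exact hd X hX hdX ▸ hyX
      · intro hy
        exact (hind d y).2 ⟨B, hB, hdB, hy⟩
    have hpre : IsPreblock R B := fun x hx y hy => (hind x y).2 ⟨B, hB, hx, hy⟩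
    subst heq
    exact ⟨_, key d hpre, d, hdB, rfl, ha, hb⟩
  tfae_finish
end

section
/- Let R be a tolerance on a set U. The complete lattices ℘(U)^▽ and ℘(U)^△ are completely distributive if and only if R is the tolerance induced by some irredundant covering of U. -/
open Set

universe u v

theorem irr_iff {U : Type u} (R : U → U → Prop) (hR : Tolerance R) :
    (∃ H : Set (Set U), IsIrredundantCovering H ∧ InducedBy R H) ↔
      ∀ x y, R x y → ∃ d, R d x ∧ R d y ∧ IsPreblock R (tolNbhd R d) := by
  obtain ⟨hr, hs⟩ := hR
  constructor
  · rintro ⟨H, ⟨⟨hne, hcov⟩, hirr⟩, hind⟩ x y hxy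
    obtain ⟨B, hB, hx, hy⟩ := (hind x y).1 hxy
    have h1 : ∃ d, ∀ C ∈ H, d ∈ C → C = B := by
      by_contra hcon
      push Not at hcon
      apply hirr B hB
      refine ⟨fun X hX => hne X hX.1, ?_⟩
      ext d
      simp only [mem_sUnion, mem_univ, iff_true]
      obtain ⟨C, hC, hd, hCB⟩ := hcon d
      exact ⟨C, ⟨hC, hCB⟩, hd⟩
    obtain ⟨d, hd⟩ := h1
    have hdB : d ∈ B := by
      have : d ∈ ⋃₀ H := by rw [hcov]; trivial
      obtain ⟨C, hC, hdC⟩ := this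
      exact hd C hC hdC ▸ hdC
    refine ⟨d, (hind _ _).2 ⟨B, hB, hdB, hx⟩, (hind _ _).2 ⟨B, hB, hdB, hy⟩, ?_⟩
    have key : ∀ a, R d a → a ∈ B := by
      intro a ha
      obtain ⟨C, hC, hdC, haC⟩ := (hind _ _).1 ha
      exact hd C hC hdC ▸ haC
    intro a ha b hb
    exact (hind _ _).2 ⟨B, hB, key a ha, key b hb⟩
  · intro h
    refine ⟨{B | ∃ d, IsPreblock R (tolNbhd R d) ∧ B = tolNbhd R d}, ⟨⟨?_, ?_⟩, ?_⟩, ?_⟩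
    · rintro X ⟨d, _, rfl⟩
      exact ⟨d, hr d⟩
    · ext x
      simp only [mem_sUnion, mem_univ, iff_true]
      obtain ⟨d, hd, _, hp⟩ := h x x (hr x)
      exact ⟨_, ⟨d, hp, rfl⟩, hd⟩
    · rintro X ⟨d, hp, rfl⟩ ⟨_, hc⟩
      have : d ∈ ⋃₀ ({B | ∃ d, IsPreblock R (tolNbhd R d) ∧ B = tolNbhd R d} \ {tolNbhd R d}) := by
        rw [hc]; trivial
      obtain ⟨C, ⟨⟨e, he, rfl⟩, hne⟩, hd⟩ := this
      apply hne
      ext a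
      exact ⟨fun ha => he d hd a ha, fun ha => hp e (hs hd) a ha⟩
    · intro x y
      constructor
      · intro hxy
        obtain ⟨d, hx, hy, hp⟩ := h x y hxy
        exact ⟨_, ⟨d, hp, rfl⟩, hx, hy⟩
      · rintro ⟨B, ⟨d, hp, rfl⟩, hx, hy⟩
        exact hp x hx y hy

theorem stmt_5 {U : Type u} (R : U → U → Prop) (hR : Tolerance R) :
    ((∀ (I J : Type u) (x : I → J → Set U),
        (∀ i j, x i j ∈ Set.range (lowerApprox R)) →
        ⋂ i, lowerApprox R (upperApprox R (⋃ j, x i j)) =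
          lowerApprox R (upperApprox R (⋃ f : I → J, ⋂ i, x i (f i)))) ∧
     (∀ (I J : Type u) (y : I → J → Set U),
        (∀ i j, y i j ∈ Set.range (upperApprox R)) →
        upperApprox R (lowerApprox R (⋂ i, ⋃ j, y i j)) =
          ⋃ f : I → J, upperApprox R (lowerApprox R (⋂ i, y i (f i))))) ↔
      ∃ H : Set (Set U), IsIrredundantCovering H ∧ InducedBy R H := by
  rw [irr_iff R hR]
  obtain ⟨hr, hs⟩ := hR
  constructor
  · rintro ⟨-, h⟩ x y hxy
    have h0 := h {S : Set U // tolNbhd R x ⊆ upperApprox R S} U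
      (fun S z => upperApprox R (S.1 ∩ {z})) (fun S z => ⟨_, rfl⟩)
    have hy : y ∈ upperApprox R (lowerApprox R (⋂ S : {S : Set U // tolNbhd R x ⊆ upperApprox R S},
        ⋃ z, upperApprox R (S.1 ∩ {z}))) := by
      refine ⟨x, hs hxy, ?_⟩
      intro a ha
      simp only [mem_iInter, mem_iUnion]
      intro S
      obtain ⟨s, hs1, hs2⟩ := S.2 ha
      exact ⟨s, s, hs1, hs2, rfl⟩
    rw [h0] at hy
    obtain ⟨f, z, hyz, hz⟩ := mem_iUnion.1 hy
    have hz' : ∀ S : Set U, tolNbhd R x ⊆ upperApprox R S → ∃ s ∈ S, ∀ a, R z a → R a s := by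
      intro S hS
      have h2 : ∀ a, R z a → f ⟨S, hS⟩ ∈ S ∧ R a (f ⟨S, hS⟩) := by
        intro a ha
        obtain ⟨s, hs1, hs2, hs3⟩ := mem_iInter.1 (hz ha) ⟨S, hS⟩
        have hs4 : s = f ⟨S, hS⟩ := hs3
        subst hs4
        exact ⟨hs2, hs1⟩
      exact ⟨_, (h2 z (hr z)).1, fun a ha => (h2 a ha).2⟩
    have hzx : R z x := by
      obtain ⟨s, hs1, hs2⟩ := hz' {x} (fun a ha => ⟨x, hs ha, rfl⟩)
      have hs3 : s = x := hs1
      subst hs3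
      exact hs2 z (hr z)
    have hw : ∃ w, R x w ∧ ∀ s, R w s → ∀ a, R z a → R a s := by
      by_contra hcon
      push Not at hcon
      obtain ⟨s, ⟨b, hb, hb'⟩, hs2⟩ := hz' {s | ∃ a, R z a ∧ ¬ R a s} (by
        intro w hw
        obtain ⟨s, h1, a, h2, h3⟩ := hcon w hw
        exact ⟨s, h1, a, h2, h3⟩)
      exact hb' (hs2 b hb)
    obtain ⟨w, hxw, hw⟩ := hw
    refine ⟨z, hzx, hs hyz, ?_⟩
    intro a ha b hb
    exact hw b (hs (hw w (hr w) b hb)) a ha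
  · intro h
    refine ⟨fun I J x hx => ?_, fun I J y hy => ?_⟩
    · ext p
      constructor
      · intro hp q hq
        obtain ⟨d, hdp, hdq, hd⟩ := h p q hq
        have h1 : ∀ i, ∃ j, d ∈ x i j := by
          intro i
          obtain ⟨e, he, he'⟩ := mem_iInter.1 hp i (hs hdp)
          obtain ⟨j, hj⟩ := mem_iUnion.1 he'
          obtain ⟨X, hX⟩ := hx i j
          refine ⟨j, ?_⟩
          rw [← hX] at hj ⊢
          exact fun a ha => hj (hd e he a ha)
        choose f hf using h1
        exact ⟨d, hs hdq, mem_iUnion.2 ⟨f, mem_iInter.2 hf⟩⟩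
      · intro hp
        refine mem_iInter.2 fun i q hq => ?_
        obtain ⟨r, hr1, hr2⟩ := hp hq
        obtain ⟨f, hf⟩ := mem_iUnion.1 hr2
        exact ⟨r, hr1, mem_iUnion.2 ⟨f i, mem_iInter.1 hf i⟩⟩
    · ext p
      constructor
      · rintro ⟨q, hpq, hq⟩
        obtain ⟨d, hdp, hdq, hd⟩ := h p q hpq
        have h1 : ∀ i, ∃ j, tolNbhd R d ⊆ y i j := by
          intro i
          obtain ⟨j, hj⟩ := mem_iUnion.1 (mem_iInter.1 (hq (hs hdq)) i)
          obtain ⟨X, hX⟩ := hy i j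
          refine ⟨j, ?_⟩
          rw [← hX] at hj ⊢
          obtain ⟨e, he, heX⟩ := hj
          exact fun a ha => ⟨e, hd a ha e he, heX⟩
        choose f hf using h1
        exact mem_iUnion.2 ⟨f, d, hs hdp, fun a ha => mem_iInter.2 fun i => hf i ha⟩
      · intro hp
        obtain ⟨f, q, hq, hq'⟩ := mem_iUnion.1 hp
        exact ⟨q, hq, fun a ha => mem_iInter.2 fun i => mem_iUnion.2 ⟨f i, mem_iInter.1 (hq' ha) i⟩⟩
end

section
/- Let H be a covering of a set U and let R be the tolerance induced by H. Then H is irredundant if and only if for each B ∈ H there exists d ∈ U such that R(d) = B. -/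
open Set

universe u v

theorem stmt_6 {U : Type*} (H : Set (Set U)) (hH : IsCovering H)
    (R : U → U → Prop) (hR : InducedBy R H) :
    IsIrredundantCovering H ↔ ∀ B ∈ H, ∃ d : U, tolNbhd R d = B := by
  have hcov : ∀ x : U, ∃ C ∈ H, x ∈ C := fun x => by
    have hx : x ∈ ⋃₀ H := by rw [hH.2]; exact Set.mem_univ x
    exact hx
  constructor
  · intro hI B hB
    by_contra hno
    apply hI.2 B hB
    refine ⟨fun X hX => hH.1 X hX.1, Set.eq_univ_of_forall fun d => ?_⟩
    by_contra hd
    have honly : ∀ C ∈ H, d ∈ C → C = B := by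
      intro C hC hdC
      by_contra hne
      exact hd ⟨C, ⟨hC, hne⟩, hdC⟩
    apply hno
    refine ⟨d, Set.ext fun y => ?_⟩
    change R d y ↔ y ∈ B
    rw [hR]
    constructor
    · rintro ⟨C, hC, hdC, hyC⟩
      exact honly C hC hdC ▸ hyC
    · intro hy
      obtain ⟨C, hC, hdC⟩ := hcov d
      have hCB := honly C hC hdC
      subst hCB
      exact ⟨C, hC, hdC, hy⟩
  · intro h
    refine ⟨hH, fun B hB hc => ?_⟩
    have hsub : ∀ C ∈ H, ∀ x ∈ C, C ⊆ tolNbhd R x := fun C hC x hx y hy =>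
      (hR x y).2 ⟨C, hC, hx, hy⟩
    have hrefl : ∀ x, x ∈ tolNbhd R x := fun x => by
      obtain ⟨C, hC, hx⟩ := hcov x
      exact hsub C hC x hx hx
    obtain ⟨d, hd⟩ := h B hB
    have hdu : d ∈ ⋃₀ (H \ {B}) := by rw [hc.2]; exact Set.mem_univ d
    obtain ⟨C, ⟨hC, hne⟩, hdC⟩ := hdu
    have hCB : C ⊆ B := hd ▸ hsub C hC d hdC
    obtain ⟨c, hcC⟩ := h C hC
    have hcc : c ∈ C := by
      have := hrefl c
      rwa [hcC] at this
    have hBC : B ⊆ C := by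
      have := hsub B hB c (hCB hcc)
      rwa [hcC] at this
    exact hne (Set.Subset.antisymm hCB hBC)
end

section
/- Let R be a tolerance induced by an irredundant covering of a set U. Then ℘(U)^▽ and ℘(U)^△, ordered by inclusion, are atomistic Boolean lattices (complemented distributive lattices in which every element is a join of atoms), and their sets of atoms are exactly {R(x)^▽ | x ∈ U and R(x) is a block of R} and {R(x) | x ∈ U and R(x) is a block of R}, respectively. -/
open Set

universe u v

def AtomOfLow {U : Type*} (R : U → U → Prop) (A : Set U) : Prop :=
  A ∈ Set.range (lowerApprox R) ∧ A ≠ ∅ ∧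
    ∀ B ∈ Set.range (lowerApprox R), B ⊆ A → B = ∅ ∨ B = A

def AtomOfUp {U : Type*} (R : U → U → Prop) (A : Set U) : Prop :=
  A ∈ Set.range (upperApprox R) ∧ A ≠ ∅ ∧
    ∀ B ∈ Set.range (upperApprox R), B ⊆ A → B = ∅ ∨ B = A

theorem aux_mem_lower {U : Type*} (R : U → U → Prop) (X : Set U) (x : U) :
    x ∈ lowerApprox R X ↔ ∀ y, R x y → y ∈ X := Iff.rfl

theorem aux_mem_upper {U : Type*} (R : U → U → Prop) (X : Set U) (x : U) :
    x ∈ upperApprox R X ↔ ∃ y, R x y ∧ y ∈ X := Iff.rfl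

/-- Every related pair lies in a common neighbourhood that is a block. -/
theorem aux_key {U : Type*} (R : U → U → Prop)
    (H : Set (Set U)) (hH : IsIrredundantCovering H) (hind : InducedBy R H) (u v : U)
    (huv : R u v) :
    ∃ p, (∀ x, R p x → ∀ y, R p y → R x y) ∧ R p u ∧ R p v := by
  obtain ⟨B, hB, hu, hv⟩ := (hind u v).1 huv
  have h1 : ∃ p, ∀ C ∈ H, p ∈ C → C = B := by
    by_contra hcon
    push Not at hcon
    refine hH.2 B hB ⟨fun X hX => hH.1.1 X hX.1, ?_⟩
    ext p
    obtain ⟨C, hC, hp, hne⟩ := hcon p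
    simp only [mem_univ, iff_true]
    exact ⟨C, ⟨hC, hne⟩, hp⟩
  obtain ⟨p, hp⟩ := h1
  have hpB : p ∈ B := by
    have : p ∈ ⋃₀ H := by rw [hH.1.2]; trivial
    obtain ⟨C, hC, hpC⟩ := this
    rw [← hp C hC hpC]; exact hpC
  have hR : ∀ y, R p y → y ∈ B := by
    intro y hy
    obtain ⟨C, hC, hpC, hyC⟩ := (hind p y).1 hy
    rw [← hp C hC hpC]; exact hyC
  exact ⟨p, fun x hx y hy => (hind x y).2 ⟨B, hB, hR x hx, hR y hy⟩,
    (hind p u).2 ⟨B, hB, hpB, hu⟩, (hind p v).2 ⟨B, hB, hpB, hv⟩⟩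

theorem aux_block {U : Type*} (R : U → U → Prop) (hr : ∀ x, R x x) (p : U) :
    IsBlock R (tolNbhd R p) ↔ ∀ x, R p x → ∀ y, R p y → R x y := by
  constructor
  · intro h; exact h.1
  · intro h
    refine ⟨h, fun C hC hs => subset_antisymm hs ?_⟩
    intro y hy
    exact hC p (hs (hr p)) y hy

theorem stmt_7 {U : Type*} (R : U → U → Prop) (hR : Tolerance R)
    (H : Set (Set U)) (hH : IsIrredundantCovering H) (hind : InducedBy R H) :
    -- ℘(U)^▽ is a bounded lattice (meet = ∩, join = (∪)^{△▽}) ...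
    ((∅ : Set U) ∈ Set.range (lowerApprox R) ∧ (Set.univ : Set U) ∈ Set.range (lowerApprox R)) ∧
    -- ... which is distributive ...
    (∀ A ∈ Set.range (lowerApprox R), ∀ B ∈ Set.range (lowerApprox R),
      ∀ C ∈ Set.range (lowerApprox R),
      A ∩ lowerApprox R (upperApprox R (B ∪ C)) =
        lowerApprox R (upperApprox R ((A ∩ B) ∪ (A ∩ C)))) ∧
    -- ... and complemented ...
    (∀ A ∈ Set.range (lowerApprox R), ∃ B ∈ Set.range (lowerApprox R),
      A ∩ B = ∅ ∧ lowerApprox R (upperApprox R (A ∪ B)) = Set.univ) ∧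
    -- ... and atomistic (every element is the join of the atoms below it) ...
    (∀ A ∈ Set.range (lowerApprox R),
      A = lowerApprox R (upperApprox R (⋃₀ {B : Set U | AtomOfLow R B ∧ B ⊆ A}))) ∧
    -- ... with atoms exactly {R(x)^▽ | R(x) a block}.
    ({A : Set U | AtomOfLow R A} =
      {A : Set U | ∃ x : U, IsBlock R (tolNbhd R x) ∧ A = lowerApprox R (tolNbhd R x)}) ∧
    -- ℘(U)^△ is a bounded lattice (meet = (∩)^{▽△}, join = ∪) ...
    ((∅ : Set U) ∈ Set.range (upperApprox R) ∧ (Set.univ : Set U) ∈ Set.range (upperApprox R)) ∧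
    (∀ A ∈ Set.range (upperApprox R), ∀ B ∈ Set.range (upperApprox R),
      ∀ C ∈ Set.range (upperApprox R),
      upperApprox R (lowerApprox R (A ∩ (B ∪ C))) =
        upperApprox R (lowerApprox R (A ∩ B)) ∪ upperApprox R (lowerApprox R (A ∩ C))) ∧
    (∀ A ∈ Set.range (upperApprox R), ∃ B ∈ Set.range (upperApprox R),
      upperApprox R (lowerApprox R (A ∩ B)) = ∅ ∧ A ∪ B = Set.univ) ∧
    (∀ A ∈ Set.range (upperApprox R),
      A = ⋃₀ {B : Set U | AtomOfUp R B ∧ B ⊆ A}) ∧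
    ({A : Set U | AtomOfUp R A} =
      {A : Set U | ∃ x : U, IsBlock R (tolNbhd R x) ∧ A = tolNbhd R x}) := by
  obtain ⟨hr, hs⟩ := hR
  have hr : ∀ x, R x x := fun x => hr x
  have hs : ∀ x y, R x y → R y x := fun x y h => hs h
  have K := aux_key R H hH hind
  simp only [aux_block R hr]
  clear hH hind H
  -- the lower side
  have Lgood : ∀ A ∈ Set.range (lowerApprox R), ∀ p, (∀ x, R p x → ∀ y, R p y → R x y) →
      ∀ a ∈ A, R p a → p ∈ A := by
    rintro _ ⟨X, rfl⟩ p hp a ha hpa y hy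
    exact ha (hp a hpa y hy)
  have Lext : ∀ A ∈ Set.range (lowerApprox R), ∀ B ∈ Set.range (lowerApprox R),
      (∀ p, (∀ x, R p x → ∀ y, R p y → R x y) → p ∈ A → p ∈ B) → A ⊆ B := by
    rintro A hA _ ⟨X, rfl⟩ h u hu v huv
    obtain ⟨p, hp, hpu, hpv⟩ := K u v huv
    exact h p hp (Lgood A hA p hp u hu hpu) hpv
  have Ljoin : ∀ Y : Set U, (∀ p, (∀ x, R p x → ∀ y, R p y → R x y) →
      ∀ a ∈ Y, R p a → p ∈ Y) → ∀ p, (∀ x, R p x → ∀ y, R p y → R x y) →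
      (p ∈ lowerApprox R (upperApprox R Y) ↔ p ∈ Y) := by
    intro Y hY p hp
    constructor
    · intro h
      obtain ⟨y, hpy, hy⟩ := h (hr p)
      exact hY p hp y hy hpy
    · intro h y hy
      exact ⟨p, hs _ _ hy, h⟩
  have Linter : ∀ A ∈ Set.range (lowerApprox R), ∀ B ∈ Set.range (lowerApprox R),
      A ∩ B ∈ Set.range (lowerApprox R) := by
    rintro _ ⟨X, rfl⟩ _ ⟨Y, rfl⟩
    refine ⟨X ∩ Y, ?_⟩
    ext u
    exact subset_inter_iff
  have Lunion : ∀ A ∈ Set.range (lowerApprox R), ∀ B ∈ Set.range (lowerApprox R),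
      ∀ p, (∀ x, R p x → ∀ y, R p y → R x y) → ∀ a ∈ A ∪ B, R p a → p ∈ A ∪ B := by
    rintro A hA B hB p hp a (ha | ha) hpa
    · exact Or.inl (Lgood A hA p hp a ha hpa)
    · exact Or.inr (Lgood B hB p hp a ha hpa)
  have Latom : ∀ p, (∀ x, R p x → ∀ y, R p y → R x y) →
      AtomOfLow R (lowerApprox R (tolNbhd R p)) := by
    intro p hp
    refine ⟨⟨_, rfl⟩, Set.Nonempty.ne_empty ⟨p, fun y hy => hy⟩, ?_⟩
    intro B hB hsub
    rcases B.eq_empty_or_nonempty with h | ⟨u, hu⟩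
    · exact Or.inl h
    · right
      refine subset_antisymm hsub (Lext _ ⟨_, rfl⟩ B hB ?_)
      intro q' hq' hq'm
      have h1 : R p u := hsub hu (hr u)
      have hpB : p ∈ B := Lgood B hB p hp u hu h1
      exact Lgood B hB q' hq' p hpB (hs _ _ (hq'm (hr q')))
  have Lbelow : ∀ A ∈ Set.range (lowerApprox R), ∀ p ∈ A, 
      lowerApprox R (tolNbhd R p) ⊆ A := by
    intro A hA p hpA
    refine Lext _ ⟨_, rfl⟩ A hA ?_
    intro q hq hqm
    exact Lgood A hA q hq p hpA (hs _ _ (hqm (hr q)))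
  -- the upper side
  have Ugood : ∀ A ∈ Set.range (upperApprox R), ∀ p, (∀ x, R p x → ∀ y, R p y → R x y) →
      p ∈ A → ∀ y, R p y → y ∈ A := by
    rintro _ ⟨X, rfl⟩ p hp ⟨x, hpx, hx⟩ y hy
    exact ⟨x, hp y hy x hpx, hx⟩
  have Urep : ∀ A ∈ Set.range (upperApprox R), ∀ u ∈ A,
      ∃ p, (∀ x, R p x → ∀ y, R p y → R x y) ∧ R p u ∧ p ∈ A := by
    rintro _ ⟨X, rfl⟩ u ⟨x, hux, hx⟩
    obtain ⟨p, hp, hpu, hpx⟩ := K u x hux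
    exact ⟨p, hp, hpu, x, hpx, hx⟩
  have Umeet : ∀ Y : Set U, (∀ p, (∀ x, R p x → ∀ y, R p y → R x y) →
      p ∈ Y → ∀ y, R p y → y ∈ Y) → ∀ u, (u ∈ upperApprox R (lowerApprox R Y) ↔
      ∃ p, (∀ x, R p x → ∀ y, R p y → R x y) ∧ R p u ∧ p ∈ Y) := by
    intro Y hY u
    constructor
    · rintro ⟨v, huv, hv⟩
      obtain ⟨p, hp, hpu, hpv⟩ := K u v huv
      exact ⟨p, hp, hpu, hv (hs _ _ hpv)⟩
    · rintro ⟨p, hp, hpu, hpY⟩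
      exact ⟨p, hs _ _ hpu, fun y hy => hY p hp hpY y hy⟩
  have Uinter : ∀ A ∈ Set.range (upperApprox R), ∀ B ∈ Set.range (upperApprox R),
      ∀ p, (∀ x, R p x → ∀ y, R p y → R x y) →
      p ∈ A ∩ B → ∀ y, R p y → y ∈ A ∩ B := by
    intro A hA B hB p hp h y hy
    exact ⟨Ugood A hA p hp h.1 y hy, Ugood B hB p hp h.2 y hy⟩
  have Uunion : ∀ A ∈ Set.range (upperApprox R), ∀ B ∈ Set.range (upperApprox R),
      A ∪ B ∈ Set.range (upperApprox R) := by
    rintro _ ⟨X, rfl⟩ _ ⟨Y, rfl⟩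
    refine ⟨X ∪ Y, ?_⟩
    ext u
    simp only [aux_mem_upper, mem_union]
    constructor
    · rintro ⟨y, h, h' | h'⟩
      exacts [Or.inl ⟨y, h, h'⟩, Or.inr ⟨y, h, h'⟩]
    · rintro (⟨y, h, h'⟩ | ⟨y, h, h'⟩)
      exacts [⟨y, h, Or.inl h'⟩, ⟨y, h, Or.inr h'⟩]
  have Unb : ∀ p, tolNbhd R p ∈ Set.range (upperApprox R) := by
    intro p
    refine ⟨{p}, ?_⟩
    ext u
    simp only [aux_mem_upper, mem_singleton_iff, exists_eq_right]
    exact ⟨hs _ _, hs _ _⟩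
  have Uatom : ∀ p, (∀ x, R p x → ∀ y, R p y → R x y) → AtomOfUp R (tolNbhd R p) := by
    intro p hp
    refine ⟨Unb p, Set.Nonempty.ne_empty ⟨p, hr p⟩, ?_⟩
    intro B hB hsub
    rcases B.eq_empty_or_nonempty with h | ⟨u, hu⟩
    · exact Or.inl h
    · right
      refine subset_antisymm hsub ?_
      obtain ⟨q, hq, hqu, hqB⟩ := Urep B hB u hu
      have hpq : R p q := hsub hqB
      have hpB : p ∈ B := Ugood B hB q hq hqB p (hs _ _ hpq)
      intro y hy
      exact Ugood B hB p hp hpB y hy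
  refine ⟨⟨⟨∅, ?_⟩, ⟨univ, ?_⟩⟩, ?_, ?_, ?_, ?_, ⟨⟨∅, ?_⟩, ⟨univ, ?_⟩⟩, ?_, ?_, ?_, ?_⟩
  · ext u
    simp only [aux_mem_lower, mem_empty_iff_false, iff_false]
    exact fun h => h u (hr u)
  · ext u
    simp [aux_mem_lower]
  · intro A hA B hB C hC
    have hAB := Linter A hA B hB
    have hAC := Linter A hA C hC
    have hl := Linter A hA _ ⟨upperApprox R (B ∪ C), rfl⟩
    have e : ∀ p, (∀ x, R p x → ∀ y, R p y → R x y) →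
        (p ∈ A ∩ lowerApprox R (upperApprox R (B ∪ C)) ↔
        p ∈ lowerApprox R (upperApprox R ((A ∩ B) ∪ (A ∩ C)))) := by
      intro p hp
      rw [mem_inter_iff, Ljoin _ (Lunion B hB C hC) p hp, Ljoin _ (Lunion _ hAB _ hAC) p hp,
        ← inter_union_distrib_left, mem_inter_iff]
    exact subset_antisymm (Lext _ hl _ ⟨_, rfl⟩ fun p hp => (e p hp).1)
      (Lext _ ⟨_, rfl⟩ _ hl fun p hp => (e p hp).2)
  · intro A hA
    refine ⟨lowerApprox R Aᶜ, ⟨_, rfl⟩, ?_, ?_⟩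
    · ext u
      simp only [mem_inter_iff, mem_empty_iff_false, iff_false]
      rintro ⟨h1, h2⟩
      exact h2 (hr u) h1
    · refine subset_antisymm (subset_univ _) ?_
      refine Lext _ ⟨univ, ?_⟩ _ ⟨_, rfl⟩ ?_
      · ext u
        simp [aux_mem_lower]
      · intro p hp _
        rw [Ljoin _ (Lunion A hA _ ⟨_, rfl⟩) p hp]
        by_cases h : p ∈ A
        · exact Or.inl h
        · exact Or.inr fun y hy hyA => h (Lgood A hA p hp y hyA hy)
  · intro A hA
    have hg : ∀ p, (∀ x, R p x → ∀ y, R p y → R x y) →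
        ∀ a ∈ ⋃₀ {B : Set U | AtomOfLow R B ∧ B ⊆ A}, R p a →
          p ∈ ⋃₀ {B : Set U | AtomOfLow R B ∧ B ⊆ A} := by
      rintro p hp a ⟨B, hB, haB⟩ hpa
      exact ⟨B, hB, Lgood B hB.1.1 p hp a haB hpa⟩
    refine subset_antisymm (Lext _ hA _ ⟨_, rfl⟩ ?_) (Lext _ ⟨_, rfl⟩ _ hA ?_)
    · intro p hp hpA
      rw [Ljoin _ hg p hp]
      exact ⟨_, ⟨Latom p hp, Lbelow A hA p hpA⟩, fun y hy => hy⟩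
    · intro p hp h
      rw [Ljoin _ hg p hp] at h
      obtain ⟨B, hB, hpB⟩ := h
      exact hB.2 hpB
  · ext A
    constructor
    · rintro ⟨hA, hne, hmin⟩
      obtain ⟨u, hu⟩ := Set.nonempty_iff_ne_empty.2 hne
      obtain ⟨p, hp, hpu, -⟩ := K u u (hr u)
      have hpA := Lgood A hA p hp u hu hpu
      refine ⟨p, hp, ?_⟩
      rcases hmin _ ⟨_, rfl⟩ (Lbelow A hA p hpA) with h | h
      · exact absurd h (Latom p hp).2.1
      · exact h.symm
    · rintro ⟨p, hp, rfl⟩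
      exact Latom p hp
  · ext u
    simp [aux_mem_upper]
  · ext u
    simp only [aux_mem_upper, mem_univ, and_true, iff_true]
    exact ⟨u, hr u⟩
  · intro A hA B hB C hC
    ext u
    rw [mem_union, Umeet _ (Uinter A hA _ (Uunion B hB C hC)), Umeet _ (Uinter A hA B hB),
      Umeet _ (Uinter A hA C hC)]
    constructor
    · rintro ⟨p, hp, hpu, hA', h | h⟩
      exacts [Or.inl ⟨p, hp, hpu, hA', h⟩, Or.inr ⟨p, hp, hpu, hA', h⟩]
    · rintro (⟨p, hp, hpu, hA', h⟩ | ⟨p, hp, hpu, hA', h⟩)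
      exacts [⟨p, hp, hpu, hA', Or.inl h⟩, ⟨p, hp, hpu, hA', Or.inr h⟩]
  · intro A hA
    refine ⟨upperApprox R Aᶜ, ⟨_, rfl⟩, ?_, ?_⟩
    · ext u
      rw [Umeet _ (Uinter A hA _ ⟨_, rfl⟩)]
      simp only [mem_empty_iff_false, iff_false]
      rintro ⟨p, hp, -, hpA, y, hpy, hy⟩
      exact hy (Ugood A hA p hp hpA y hpy)
    · refine subset_antisymm (subset_univ _) fun u _ => ?_
      by_cases h : u ∈ A
      · exact Or.inl h
      · exact Or.inr ⟨u, hr u, h⟩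
  · intro A hA
    refine subset_antisymm ?_ (sUnion_subset fun B hB => hB.2)
    intro u hu
    obtain ⟨p, hp, hpu, hpA⟩ := Urep A hA u hu
    exact ⟨_, ⟨Uatom p hp, fun y hy => Ugood A hA p hp hpA y hy⟩, hpu⟩
  · ext A
    constructor
    · rintro ⟨hA, hne, hmin⟩
      obtain ⟨u, hu⟩ := Set.nonempty_iff_ne_empty.2 hne
      obtain ⟨p, hp, hpu, hpA⟩ := Urep A hA u hu
      refine ⟨p, hp, ?_⟩
      rcases hmin _ (Unb p) (fun y hy => Ugood A hA p hp hpA y hy) with h | h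
      · exact absurd h (Uatom p hp).2.1
      · exact h.symm
    · rintro ⟨p, hp, rfl⟩
      exact Uatom p hp
end

section
/- Let R be a tolerance on a set U. Then the ordered set RS = {(X^▽, X^△) | X ⊆ U} is order-isomorphic to the ordered set {(X^{▽△}, X^{△▽}) | X ⊆ U} (both ordered coordinatewise by inclusion), via the map (X^▽, X^△) ↦ (X^{▽△}, X^{△▽}). -/
open Set

universe u v

def RSpairs2 {U : Type*} (R : U → U → Prop) : Set (Set U × Set U) :=
  {p | ∃ X : Set U, p = (upperApprox R (lowerApprox R X), lowerApprox R (upperApprox R X))}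

theorem approx_gc {U : Type*} (R : U → U → Prop) (hR : Tolerance R) :
    GaloisConnection (upperApprox R) (lowerApprox R) := by
  intro X Y
  constructor
  · intro h x hx y hy
    exact h ⟨x, hR.2 hy, hx⟩
  · rintro h x ⟨y, hxy, hy⟩
    exact h hy (hR.2 hxy)

theorem stmt_9 {U : Type*} (R : U → U → Prop) (hR : Tolerance R) :
    ∃ e : ↥(RSpairs R) ≃o ↥(RSpairs2 R),
      ∀ X : Set U,
        ((e ⟨(lowerApprox R X, upperApprox R X), ⟨X, rfl⟩⟩ : ↥(RSpairs2 R)) : Set U × Set U) =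
          (upperApprox R (lowerApprox R X), lowerApprox R (upperApprox R X)) := by
  have gc := approx_gc R hR
  refine ⟨{ toFun := fun p => ⟨(upperApprox R p.1.1, lowerApprox R p.1.2), ?_⟩
            invFun := fun q => ⟨(lowerApprox R q.1.1, upperApprox R q.1.2), ?_⟩
            left_inv := ?_
            right_inv := ?_
            map_rel_iff' := ?_ }, fun X => rfl⟩
  · obtain ⟨⟨a, b⟩, X, h⟩ := p
    cases h
    exact ⟨X, rfl⟩
  · obtain ⟨⟨a, b⟩, X, h⟩ := q
    cases h
    exact ⟨X, Prod.ext (gc.u_l_u_eq_u X) (gc.l_u_l_eq_l X)⟩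
  · rintro ⟨⟨a, b⟩, X, h⟩
    cases h
    exact Subtype.ext (Prod.ext (gc.u_l_u_eq_u X) (gc.l_u_l_eq_l X))
  · rintro ⟨⟨a, b⟩, X, h⟩
    cases h
    exact Subtype.ext (Prod.ext (gc.l_u_l_eq_l _) (gc.u_l_u_eq_u _))
  · rintro ⟨⟨a, b⟩, X, h⟩ ⟨⟨c, d⟩, Y, h'⟩
    cases h
    cases h'
    constructor
    · rintro ⟨h1, h2⟩
      refine ⟨?_, ?_⟩
      · have : lowerApprox R (upperApprox R (lowerApprox R X)) ≤
            lowerApprox R (upperApprox R (lowerApprox R Y)) := gc.monotone_u h1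
        simpa only [gc.u_l_u_eq_u] using this
      · have : upperApprox R (lowerApprox R (upperApprox R X)) ≤
            upperApprox R (lowerApprox R (upperApprox R Y)) := gc.monotone_l h2
        simpa only [gc.l_u_l_eq_l] using this
    · rintro ⟨h1, h2⟩
      exact ⟨gc.monotone_l h1, gc.monotone_u h2⟩
end

section
/- Let R be a tolerance on a set U and let S = {x ∈ U | R(x) = {x}}. Define I(RS) = {(A, B) ∈ ℘(U)^▽ × ℘(U)^△ | A^△ ⊆ B^▽ and S ⊆ A ∪ Bᶜ}. Then: (i) RS ⊆ I(RS); (ii) I(RS) is closed under the De Morgan operation ∼(A, B) = (Bᶜ, Aᶜ); (iii) I(RS) is a complete sublattice of ℘(U)^▽ × ℘(U)^△, i.e., for any family {(A_i, B_i)}_{i∈I} ⊆ I(RS), both (⋂_i A_i, (⋂_i B_i)^{▽△}) and ((⋃_i A_i)^{△▽}, ⋃_i B_i) belong to I(RS); (iv) the projections of I(RS) onto the two coordinates are surjective onto ℘(U)^▽ and ℘(U)^△ respectively, so I(RS) is a complete subdirect product of ℘(U)^▽ and ℘(U)^△. -/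
open Set

universe u v

def IRS {U : Type*} (R : U → U → Prop) : Set (Set U × Set U) :=
  {p | p.1 ∈ Set.range (lowerApprox R) ∧ p.2 ∈ Set.range (upperApprox R) ∧
       upperApprox R p.1 ⊆ lowerApprox R p.2 ∧ singl R ⊆ p.1 ∪ (p.2)ᶜ}

theorem upper_sub_iff {U : Type*} {R : U → U → Prop} (hR : Tolerance R) (X Y : Set U) :
    upperApprox R X ⊆ Y ↔ X ⊆ lowerApprox R Y := by
  constructor
  · intro h x hx y hy
    exact h ⟨x, hR.2 hy, hx⟩
  · rintro h x ⟨y, hy, hyX⟩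
    exact h hyX (hR.2 hy)

theorem lower_sub {U : Type*} {R : U → U → Prop} (hR : Tolerance R) (X : Set U) :
    lowerApprox R X ⊆ X := fun x hx => hx (hR.1 x)

theorem sub_upper {U : Type*} {R : U → U → Prop} (hR : Tolerance R) (X : Set U) :
    X ⊆ upperApprox R X := fun x hx => ⟨x, hR.1 x, hx⟩

theorem lower_upper_sub {U : Type*} {R : U → U → Prop} (hR : Tolerance R) (X : Set U) :
    upperApprox R (lowerApprox R X) ⊆ X := (upper_sub_iff hR _ _).2 subset_rfl

theorem sub_upper_lower {U : Type*} {R : U → U → Prop} (hR : Tolerance R) (X : Set U) :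
    X ⊆ lowerApprox R (upperApprox R X) := (upper_sub_iff hR _ _).1 subset_rfl

theorem RS_sub_IRS {U : Type*} {R : U → U → Prop} (hR : Tolerance R) :
    RSpairs R ⊆ IRS R := by
  rintro _ ⟨X, rfl⟩
  refine ⟨⟨X, rfl⟩, ⟨X, rfl⟩, (lower_upper_sub hR X).trans (sub_upper_lower hR X), ?_⟩
  intro x hx
  have hx' : tolNbhd R x = {x} := hx
  by_cases h : x ∈ X
  · left
    change tolNbhd R x ⊆ X
    rw [hx']
    simpa using h
  · right
    rintro ⟨y, hy, hyX⟩
    rw [hx'] at hy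
    rw [mem_singleton_iff] at hy
    exact h (hy ▸ hyX)

theorem lower_compl {U : Type*} (R : U → U → Prop) (X : Set U) :
    lowerApprox R Xᶜ = (upperApprox R X)ᶜ := by
  ext x
  constructor
  · rintro h ⟨y, hy, hX⟩
    exact h hy hX
  · intro h y hy hX
    exact h ⟨y, hy, hX⟩

theorem upper_compl {U : Type*} (R : U → U → Prop) (X : Set U) :
    upperApprox R Xᶜ = (lowerApprox R X)ᶜ := by
  have h := lower_compl R Xᶜ
  rw [compl_compl] at h
  rw [h, compl_compl]

theorem stmt_10 {U : Type u} (R : U → U → Prop) (hR : Tolerance R) :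
    -- (i)
    RSpairs R ⊆ IRS R ∧
    -- (ii)
    (∀ p ∈ IRS R, (((p : Set U × Set U).2)ᶜ, ((p : Set U × Set U).1)ᶜ) ∈ IRS R) ∧
    -- (iii)
    (∀ (ι : Type u) (f : ι → Set U × Set U), (∀ i, f i ∈ IRS R) →
      ((⋂ i, (f i).1, upperApprox R (lowerApprox R (⋂ i, (f i).2))) ∈ IRS R ∧
       (lowerApprox R (upperApprox R (⋃ i, (f i).1)), ⋃ i, (f i).2) ∈ IRS R)) ∧
    -- (iv)
    (∀ A ∈ Set.range (lowerApprox R), ∃ p ∈ IRS R, (p : Set U × Set U).1 = A) ∧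
    (∀ B ∈ Set.range (upperApprox R), ∃ p ∈ IRS R, (p : Set U × Set U).2 = B) := by
  refine ⟨RS_sub_IRS hR, ?_, ?_, ?_, ?_⟩
  · rintro ⟨_, _⟩ ⟨⟨X, rfl⟩, ⟨Y, rfl⟩, h, hS⟩
    refine ⟨⟨Yᶜ, lower_compl R Y⟩, ⟨Xᶜ, upper_compl R X⟩, ?_, ?_⟩
    · dsimp only at h ⊢
      rw [lower_compl, upper_compl]
      exact compl_subset_compl.2 h
    · dsimp only at hS ⊢
      rw [compl_compl, union_comm]
      exact hS
  · intro ι f hf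
    refine ⟨⟨?_, ⟨_, rfl⟩, ?_, ?_⟩, ⟨⟨_, rfl⟩, ?_, ?_, ?_⟩⟩
    · choose X hX using fun i => (hf i).1
      refine ⟨⋂ i, X i, ?_⟩
      ext x
      simp only [← hX, lowerApprox, mem_setOf_eq, mem_iInter, subset_iInter_iff]
    · refine Subset.trans ?_ (sub_upper_lower hR _)
      rintro x ⟨y, hy, hyA⟩ z hz
      refine mem_iInter.2 fun i => ?_
      exact (hf i).2.2.1 ⟨y, hy, mem_iInter.1 hyA i⟩ hz
    · intro x hx
      by_cases h : x ∈ ⋂ i, (f i).1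
      · exact Or.inl h
      · right
        intro hB
        refine h (mem_iInter.2 fun i => ?_)
        exact ((hf i).2.2.2 hx).resolve_right
          (fun hn => hn (mem_iInter.1 (lower_upper_sub hR _ hB) i))
    · choose X hX using fun i => (hf i).2.1
      refine ⟨⋃ i, X i, ?_⟩
      ext x
      simp only [← hX, upperApprox, mem_setOf_eq, mem_iUnion, inter_iUnion, nonempty_iUnion]
    · refine (lower_upper_sub hR _).trans ?_
      rintro x ⟨y, hy, hyA⟩ z hz
      obtain ⟨i, hi⟩ := mem_iUnion.1 hyA
      exact mem_iUnion.2 ⟨i, (hf i).2.2.1 ⟨y, hy, hi⟩ hz⟩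
    · intro x hx
      by_cases h : x ∈ ⋃ i, (f i).2
      · left
        obtain ⟨i, hi⟩ := mem_iUnion.1 h
        exact sub_upper_lower hR _
          (mem_iUnion.2 ⟨i, ((hf i).2.2.2 hx).resolve_right (fun hn => hn hi)⟩)
      · exact Or.inr h
  · rintro _ ⟨X, rfl⟩
    exact ⟨_, RS_sub_IRS hR ⟨X, rfl⟩, rfl⟩
  · rintro _ ⟨X, rfl⟩
    exact ⟨_, RS_sub_IRS hR ⟨X, rfl⟩, rfl⟩
end

section
/- Let R be a tolerance on a set U. The ordered set RS = {(X^▽, X^△) | X ⊆ U} (ordered coordinatewise by inclusion) is a complete lattice if and only if RS is a complete sublattice of the complete lattice ℘(U)^▽ × ℘(U)^△ (with surjective coordinate projections), i.e., if and only if for every family {X_i}_{i∈I} of subsets of U there exist Z, W ⊆ U such that Z^▽ = ⋂_i X_i^▽ and Z^△ = (⋂_i X_i^△)^{▽△}, and W^▽ = (⋃_i X_i^▽)^{△▽} and W^△ = ⋃_i X_i^△. -/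
open Set

universe u v

theorem pair_le {U : Type*} (R : U → U → Prop) (a b : ↥(RSpairs R)) (X Y : Set U)
    (ha : a.1 = (lowerApprox R X, upperApprox R X))
    (hb : b.1 = (lowerApprox R Y, upperApprox R Y)) :
    a ≤ b ↔ lowerApprox R X ⊆ lowerApprox R Y ∧ upperApprox R X ⊆ upperApprox R Y := by
  rw [← Subtype.coe_le_coe, ha, hb]; exact Prod.mk_le_mk

theorem stmt_11 {U : Type u} (R : U → U → Prop) (hR : Tolerance R) :
    (∀ S : Set ↥(RSpairs R), (∃ a, IsLUB S a) ∧ (∃ a, IsGLB S a)) ↔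
      ∀ (ι : Type u) (X : ι → Set U),
        (∃ Z : Set U, lowerApprox R Z = ⋂ i, lowerApprox R (X i) ∧
          upperApprox R Z = upperApprox R (lowerApprox R (⋂ i, upperApprox R (X i)))) ∧
        (∃ W : Set U, lowerApprox R W = lowerApprox R (upperApprox R (⋃ i, lowerApprox R (X i))) ∧
          upperApprox R W = ⋃ i, upperApprox R (X i)) := by
  obtain ⟨hr, hs⟩ := hR
  have hr : ∀ x, R x x := fun x => hr x
  have hs : ∀ {x y}, R x y → R y x := fun h => hs h
  constructor
  · intro H ι X
    let f : ι → ↥(RSpairs R) := fun i => ⟨(lowerApprox R (X i), upperApprox R (X i)), X i, rfl⟩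
    let g : Set U → ↥(RSpairs R) := fun Y => ⟨(lowerApprox R Y, upperApprox R Y), Y, rfl⟩
    obtain ⟨⟨⟨_, W, rfl⟩, hW⟩, ⟨⟨_, Z, rfl⟩, hZ⟩⟩ := H (Set.range f)
    have ubW : ∀ i, lowerApprox R (X i) ⊆ lowerApprox R W ∧
        upperApprox R (X i) ⊆ upperApprox R W := fun i =>
      (pair_le R _ _ (X i) W rfl rfl).1 (hW.1 ⟨i, rfl⟩)
    have lbZ : ∀ i, lowerApprox R Z ⊆ lowerApprox R (X i) ∧
        upperApprox R Z ⊆ upperApprox R (X i) := fun i =>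
      (pair_le R _ _ Z (X i) rfl rfl).1 (hZ.1 ⟨i, rfl⟩)
    have lW : ∀ Y : Set U, (∀ i, lowerApprox R (X i) ⊆ lowerApprox R Y ∧
        upperApprox R (X i) ⊆ upperApprox R Y) → lowerApprox R W ⊆ lowerApprox R Y ∧
        upperApprox R W ⊆ upperApprox R Y := by
      intro Y hY
      refine (pair_le R _ (g Y) W Y rfl rfl).1 (hW.2 ?_)
      rintro _ ⟨i, rfl⟩
      exact (pair_le R _ _ (X i) Y rfl rfl).2 (hY i)
    have gZ : ∀ Y : Set U, (∀ i, lowerApprox R Y ⊆ lowerApprox R (X i) ∧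
        upperApprox R Y ⊆ upperApprox R (X i)) → lowerApprox R Y ⊆ lowerApprox R Z ∧
        upperApprox R Y ⊆ upperApprox R Z := by
      intro Y hY
      refine (pair_le R (g Y) _ Y Z rfl rfl).1 (hZ.2 ?_)
      rintro _ ⟨i, rfl⟩
      exact (pair_le R _ _ Y (X i) rfl rfl).2 (hY i)
    clear hW hZ H
    refine ⟨⟨Z, ?_, ?_⟩, ⟨W, ?_, ?_⟩⟩
    · apply Set.Subset.antisymm
      · exact Set.subset_iInter fun i => (lbZ i).1
      · refine Set.Subset.trans ?_ (gZ (⋂ i, X i) fun i => ⟨?_, ?_⟩).1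
        · intro x hx y hy
          rw [Set.mem_iInter] at hx ⊢
          exact fun i => hx i hy
        · intro x hx y hy
          exact Set.mem_iInter.1 (hx hy) i
        · rintro x ⟨y, hy, hy'⟩
          exact ⟨y, hy, Set.mem_iInter.1 hy' i⟩
    · apply Set.Subset.antisymm
      · rintro x ⟨y, hy, hyZ⟩
        refine ⟨y, hy, fun z hz => Set.mem_iInter.2 fun i => (lbZ i).2 ⟨y, hs hz, hyZ⟩⟩
      · rintro x ⟨y, hy, hyN⟩
        refine (gZ {y} fun i => ⟨?_, ?_⟩).2 ⟨y, hy, rfl⟩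
        · intro z hz
          obtain rfl : z = y := hz (hr z)
          intro w hw
          obtain rfl : w = z := hz hw
          obtain ⟨v, hv, hv'⟩ := Set.mem_iInter.1 (hyN hw) i
          obtain rfl : v = w := hz hv
          exact hv'
        · rintro z ⟨_, hz, rfl⟩
          exact Set.mem_iInter.1 (hyN (hs hz)) i
    · have hM : upperApprox R W ⊆ ⋃ i, upperApprox R (X i) := by
        refine Set.Subset.trans (lW (⋃ i, X i) fun i => ⟨?_, ?_⟩).2 ?_
        · intro x hx y hy
          exact Set.mem_iUnion.2 ⟨i, hx hy⟩
        · rintro x ⟨y, hy, hy'⟩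
          exact ⟨y, hy, Set.mem_iUnion.2 ⟨i, hy'⟩⟩
        · rintro x ⟨y, hy, hy'⟩
          obtain ⟨i, hi⟩ := Set.mem_iUnion.1 hy'
          exact Set.mem_iUnion.2 ⟨i, y, hy, hi⟩
      apply Set.Subset.antisymm
      · intro x hx y hy
        by_contra hyL
        have hx' : x ∈ lowerApprox R {y}ᶜ := by
          refine (lW {y}ᶜ fun i => ⟨?_, ?_⟩).1 hx
          · rintro z hz w hw rfl
            exact hyL ⟨z, hs hw, Set.mem_iUnion.2 ⟨i, hz⟩⟩
          · intro z hz
            by_contra hzn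
            have key : ∀ w, R z w → w = y := by
              intro w hw
              by_contra hne
              exact hzn ⟨w, hw, hne⟩
            obtain rfl : z = y := key z (hr z)
            obtain ⟨v, hv, hv'⟩ := hz
            obtain rfl : v = z := key v hv
            refine hyL ⟨v, hv, Set.mem_iUnion.2 ⟨i, fun w hw => ?_⟩⟩
            obtain rfl : w = v := key w hw
            exact hv'
        exact hx' hy rfl
      · intro x hx y hy
        obtain ⟨z, hz, hzL⟩ := hx hy
        obtain ⟨i, hi⟩ := Set.mem_iUnion.1 hzL
        exact (ubW i).1 hi (hs hz)
    · apply Set.Subset.antisymm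
      · refine Set.Subset.trans (lW (⋃ i, X i) fun i => ⟨?_, ?_⟩).2 ?_
        · intro x hx y hy
          exact Set.mem_iUnion.2 ⟨i, hx hy⟩
        · rintro x ⟨y, hy, hy'⟩
          exact ⟨y, hy, Set.mem_iUnion.2 ⟨i, hy'⟩⟩
        · rintro x ⟨y, hy, hy'⟩
          obtain ⟨i, hi⟩ := Set.mem_iUnion.1 hy'
          exact Set.mem_iUnion.2 ⟨i, y, hy, hi⟩
      · exact Set.iUnion_subset fun i => (ubW i).2
  · intro H S
    have hX : ∀ p : ↥S, ∃ X : Set U, p.1.1 = (lowerApprox R X, upperApprox R X) :=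
      fun p => p.1.2
    choose X hX using hX
    obtain ⟨⟨Z, hZ1, hZ2⟩, ⟨W, hW1, hW2⟩⟩ := H ↥S X
    refine ⟨⟨⟨_, W, rfl⟩, ?_, ?_⟩, ⟨⟨_, Z, rfl⟩, ?_, ?_⟩⟩
    · intro p hp
      refine (pair_le R _ _ (X ⟨p, hp⟩) W (hX ⟨p, hp⟩) rfl).2 ⟨?_, ?_⟩
      · rw [hW1]
        intro x hx y hy
        exact ⟨x, hs hy, Set.mem_iUnion.2 ⟨_, hx⟩⟩
      · rw [hW2]
        exact Set.subset_iUnion (fun i => upperApprox R (X i)) _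
    · rintro ⟨_, Y, rfl⟩ hq
      have hq' : ∀ i : ↥S, _ := fun i => (pair_le R _ _ (X i) Y (hX i) rfl).1 (hq i.2)
      refine (pair_le R _ _ W Y rfl rfl).2 ⟨?_, ?_⟩
      · rw [hW1]
        intro x hx y hy
        obtain ⟨z, hz, hzL⟩ := hx hy
        obtain ⟨i, hi⟩ := Set.mem_iUnion.1 hzL
        exact (hq' i).1 hi (hs hz)
      · rw [hW2]
        exact Set.iUnion_subset fun i => (hq' i).2
    · intro p hp
      refine (pair_le R _ _ Z (X ⟨p, hp⟩) rfl (hX ⟨p, hp⟩)).2 ⟨?_, ?_⟩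
      · rw [hZ1]
        exact Set.iInter_subset (fun i => lowerApprox R (X i)) _
      · rw [hZ2]
        rintro x ⟨y, hy, hyN⟩
        exact Set.mem_iInter.1 (hyN (hs hy)) _
    · rintro ⟨_, Y, rfl⟩ hq
      have hq' : ∀ i : ↥S, _ := fun i => (pair_le R _ _ Y (X i) rfl (hX i)).1 (hq i.2)
      refine (pair_le R _ _ Y Z rfl rfl).2 ⟨?_, ?_⟩
      · rw [hZ1]
        exact Set.subset_iInter fun i => (hq' i).1
      · rw [hZ2]
        rintro x ⟨y, hy, hyY⟩
        exact ⟨y, hy, fun z hz => Set.mem_iInter.2 fun i => (hq' i).2 ⟨y, hs hz, hyY⟩⟩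
end

section
/- Let R be a tolerance on a set U, and let Y, T ⊆ U be such that Y ∈ ℘(U)^△ (equivalently Y = Y^{▽△}) and T ⊆ Y^▽. If |R(x)| ≥ 2 for all x ∈ Y \ T^△, then there exists a set S ⊆ Y^▽ \ T such that Y = S^△ ∪ T^△ and R(y) ⊈ S ∪ T for all y ∈ S. -/
open Set

universe u v

theorem exists_max_indep {U : Type*} (R : U → U → Prop) (hr : ∀ x, R x x)
    (hs : ∀ x y, R x y → R y x) (D : Set U) :
    ∃ I ⊆ D, (∀ x ∈ I, ∀ y ∈ I, R x y → x = y) ∧ ∀ x ∈ D, ∃ y ∈ I, R x y := by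
  obtain ⟨I, hI⟩ := zorn_subset {I : Set U | I ⊆ D ∧ ∀ x ∈ I, ∀ y ∈ I, R x y → x = y} (by
    intro c hc hch
    refine ⟨⋃₀ c, ⟨sUnion_subset fun s h => (hc h).1, ?_⟩, fun s h => subset_sUnion_of_mem h⟩
    rintro x ⟨s, hs, hx⟩ y ⟨t, ht, hy⟩ hxy
    rcases hch.total hs ht with h | h
    · exact (hc ht).2 x (h hx) y hy hxy
    · exact (hc hs).2 x hx y (h hy) hxy)
  refine ⟨I, hI.prop.1, hI.prop.2, fun x hx => ?_⟩
  by_contra hn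
  push Not at hn
  have h1 : insert x I ∈ {I : Set U | I ⊆ D ∧ ∀ x ∈ I, ∀ y ∈ I, R x y → x = y} := by
    refine ⟨insert_subset hx hI.prop.1, ?_⟩
    rintro a (rfl | ha) b (rfl | hb) hab
    · rfl
    · exact absurd hab (hn b hb)
    · exact absurd (hs _ _ hab) (hn a ha)
    · exact hI.prop.2 a ha b hb hab
  exact hn x (hI.le_of_ge h1 (subset_insert x I) (mem_insert x I)) (hr x)

theorem stmt_12 {U : Type*} (R : U → U → Prop) (hR : Tolerance R) (Y T : Set U)
    (hY : Y ∈ Set.range (upperApprox R)) (hT : T ⊆ lowerApprox R Y)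
    (hcard : ∀ x ∈ Y \ upperApprox R T, (tolNbhd R x).Nontrivial) :
    ∃ S : Set U, S ⊆ lowerApprox R Y \ T ∧ Y = upperApprox R S ∪ upperApprox R T ∧
      ∀ y ∈ S, ¬ tolNbhd R y ⊆ S ∪ T := by
  have hr : ∀ x, R x x := hR.1
  have hs : ∀ x y, R x y → R y x := fun x y h => hR.2 h
  -- every point of `Y` has a neighbour in the lower approximation
  have hYL : ∀ x ∈ Y, ∃ y ∈ lowerApprox R Y, R x y := by
    obtain ⟨X, rfl⟩ := hY
    rintro x ⟨y, hxy, hyX⟩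
    exact ⟨y, fun z hz => ⟨y, hs _ _ hz, hyX⟩, hxy⟩
  set L := lowerApprox R Y with hL
  have hLY : ∀ y ∈ L, ∀ z, R y z → z ∈ Y := fun y hy z hz => hy hz
  let B : Set U := {y | (y ∈ L ∧ y ∉ T) ∧ ∃ z, z ∉ L ∧ R y z}
  let D : Set U := {x | x ∈ Y ∧ (∀ t ∈ T, ¬ R x t) ∧ ∀ b ∈ B, ¬ R x b}
  have hDL : ∀ x ∈ D, x ∈ L := by
    rintro x ⟨hxY, hxT, hxB⟩
    by_contra hxL
    obtain ⟨y, hy, hxy⟩ := hYL x hxY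
    exact hxB y ⟨⟨hy, fun ht => hxT y ht hxy⟩, x, hxL, hs _ _ hxy⟩ hxy
  obtain ⟨I, hID, hind, hdom⟩ := exists_max_indep R hr hs D
  have hSL : ∀ y ∈ B ∪ I, y ∈ L ∧ y ∉ T := by
    rintro y (hy | hy)
    · exact hy.1
    · exact ⟨hDL y (hID hy), fun ht => (hID hy).2.1 y ht (hr y)⟩
  refine ⟨B ∪ I, hSL, ?_, ?_⟩
  · ext x
    constructor
    · intro hx
      by_cases h1 : ∃ t ∈ T, R x t
      · obtain ⟨t, ht, hxt⟩ := h1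
        exact Or.inr ⟨t, hxt, ht⟩
      by_cases h2 : ∃ b ∈ B, R x b
      · obtain ⟨b, hb, hxb⟩ := h2
        exact Or.inl ⟨b, hxb, Or.inl hb⟩
      push Not at h1 h2
      obtain ⟨y, hy, hxy⟩ := hdom x ⟨hx, h1, h2⟩
      exact Or.inl ⟨y, hxy, Or.inr hy⟩
    · rintro (⟨y, hxy, hy⟩ | ⟨y, hxy, hy⟩)
      · exact hLY y (hSL y hy).1 x (hs _ _ hxy)
      · exact hLY y (hT hy) x (hs _ _ hxy)
  · rintro y (hy | hy) hsub
    · obtain ⟨_, z, hz, hyz⟩ := hy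
      rcases hsub hyz with h | h
      · exact hz (hSL z h).1
      · exact hz (hT h)
    · obtain ⟨hyY, hyT, hyB⟩ := hID hy
      obtain ⟨z, hz, hzy⟩ := (hcard y ⟨hyY, fun ⟨t, hyt, ht⟩ => hyT t ht hyt⟩).exists_ne y
      rcases hsub hz with (h | h) | h
      · exact hyB z h hz
      · exact hzy (hind y hy z h hz).symm
      · exact hyT z h hz
end

section
/- Let R be a tolerance on a set U. Then RS = {(X^▽, X^△) | X ⊆ U}, ordered coordinatewise by inclusion, is an algebraic (compactly generated) completely distributive complete lattice if and only if R is the tolerance induced by some irredundant covering of U. -/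
open Set

universe u v

theorem aux_split {L : Type*} [CompletelyDistribLattice L] [IsCompactlyGenerated L]
    {a b : L} (hab : ¬ a ≤ b) :
    ∃ j m : L, j ≤ a ∧ b ≤ m ∧ ¬ j ≤ m ∧ ∀ c, c ≤ m ∨ j ≤ c := by
  have h1 : ∃ k : L, IsCompactElement k ∧ k ≤ a ∧ ¬ k ≤ b := by
    by_contra hcon
    push Not at hcon
    exact hab (le_iff_compact_le_imp.2 hcon)
  obtain ⟨k, hk, hka, hkb⟩ := h1
  obtain ⟨m, hbm, hm⟩ := zorn_le_nonempty₀ {c : L | ¬ k ≤ c} (by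
    intro c hc hch y hy
    refine ⟨sSup c, ?_, fun z hz => le_sSup hz⟩
    intro hle
    obtain ⟨x, hx, hkx⟩ := hk c (sSup c) ⟨y, hy⟩ hch.directedOn (isLUB_sSup c) hle
    exact hc hx hkx) b hkb
  have hkm : ¬ k ≤ m := hm.1
  refine ⟨sInf {c | ¬ c ≤ m}, m, sInf_le (fun h => hkm (hka.trans h)), hbm, ?_, ?_⟩
  · intro hle
    apply hkm
    have h2 : m ⊔ sInf {c | ¬ c ≤ m} = m := sup_eq_left.2 hle
    rw [← h2, sup_sInf_eq]
    refine le_iInf₂ fun c hc => ?_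
    by_contra hcon
    exact hc (le_sup_right.trans (hm.2 (y := m ⊔ c) hcon le_sup_left))
  · intro c
    by_cases h : c ≤ m
    · exact Or.inl h
    · exact Or.inr (sInf_le h)

theorem aux_ring {W : Type u} {P : Type u} [PartialOrder P] (r : W → W → Prop) (f : P → Set W)
    (hf : ∀ p q, f p ⊆ f q ↔ p ≤ q)
    (h1 : ∀ p a b, r a b → b ∈ f p → a ∈ f p)
    (h2 : ∀ S : Set W, (∀ a b, r a b → b ∈ S → a ∈ S) → ∃ p, f p = S) :
    ∃ (L : Type u) (inst : CompletelyDistribLattice L),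
       haveI := inst
       IsCompactlyGenerated L ∧ Nonempty (P ≃o L) := by
  letI : Preorder W :=
    { le := fun a b => ∀ p, b ∈ f p → a ∈ f p
      le_refl := fun a p h => h
      le_trans := fun a b c hab hbc p h => hab p (hbc p h) }
  refine ⟨LowerSet W, inferInstance, ⟨?_⟩, ?_⟩
  · intro S
    refine ⟨LowerSet.Iic '' (S : Set W), ?_, ?_⟩
    · rintro _ ⟨a, -, rfl⟩ s u - - hu hle
      have hu' := hu.sSup_eq
      subst hu'
      have ha : a ∈ sSup s := hle (LowerSet.mem_Iic_iff.2 le_rfl)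
      rw [LowerSet.mem_sSup_iff] at ha
      obtain ⟨t, ht, hat⟩ := ha
      exact ⟨t, ht, LowerSet.Iic_le.2 hat⟩
    · apply le_antisymm
      · apply sSup_le
        rintro _ ⟨a, ha, rfl⟩
        exact LowerSet.Iic_le.2 ha
      · intro a ha
        exact LowerSet.mem_sSup_iff.2 ⟨_, ⟨a, ha, rfl⟩, LowerSet.mem_Iic_iff.2 le_rfl⟩
  · let g : P → LowerSet W := fun p => ⟨f p, fun b a hab hb => hab p hb⟩
    have hg : ∀ p q, g p ≤ g q ↔ p ≤ q := fun p q => hf p q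
    let G : P ↪o LowerSet W := OrderEmbedding.ofMapLEIff g hg
    have hs : Function.Surjective G := by
      intro S
      obtain ⟨p, hp⟩ := h2 S (fun a b hab hb => S.lower (fun p => h1 p a b hab) hb)
      exact ⟨p, LowerSet.ext hp⟩
    exact ⟨RelIso.ofSurjective G hs⟩

theorem aux_forward {U : Type u} (R : U → U → Prop) (hR : Tolerance R)
    (hsplit : ∀ a b : ↥(RSpairs R), ¬ a ≤ b →
      ∃ j m : ↥(RSpairs R), j ≤ a ∧ b ≤ m ∧ ¬ j ≤ m ∧ ∀ c, c ≤ m ∨ j ≤ c)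
    (x y : U) (hxy : R x y) : ∃ d, IsPreblock R (tolNbhd R d) ∧ R d x ∧ R d y := by
  obtain ⟨hr, hs⟩ := hR
  by_cases hx : tolNbhd R x ⊆ {x}
  · have : y = x := hx hxy
    subst this
    refine ⟨y, ?_, hr y, hr y⟩
    intro u hu v hv
    have hu' : u = y := hx hu
    have hv' : v = y := hx hv
    subst hu'
    subst hv'
    exact hr _
  let rs : Set U → ↥(RSpairs R) := fun X => ⟨(lowerApprox R X, upperApprox R X), X, rfl⟩
  have hrs : ∀ p, ∃ X, p = rs X := by
    rintro ⟨_, X, rfl⟩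
    exact ⟨X, rfl⟩
  have hle : ∀ X Y, rs X ≤ rs Y ↔
      lowerApprox R X ⊆ lowerApprox R Y ∧ upperApprox R X ⊆ upperApprox R Y :=
    fun X Y => Iff.rfl
  have hN : ∀ u, u ∉ upperApprox R (tolNbhd R u)ᶜ := by
    rintro u ⟨w, hw, hw'⟩
    exact hw' hw
  have hN2 : ∀ u w, ¬ tolNbhd R w ⊆ tolNbhd R u → w ∈ upperApprox R (tolNbhd R u)ᶜ := by
    intro u w h
    obtain ⟨t, ht, ht'⟩ := Set.not_subset.1 h
    exact ⟨t, ht, ht'⟩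
  have hmono : ∀ X Y : Set U, X ⊆ Y → rs X ≤ rs Y := by
    intro X Y h
    exact ⟨fun w hw => hw.trans h, fun w ⟨t, ht, ht'⟩ => ⟨t, ht, h ht'⟩⟩
  have hxl : lowerApprox R {x} = ∅ := by
    ext w
    simp only [Set.mem_empty_iff_false, iff_false]
    intro hw
    have : w = x := hw (hr w)
    subst this
    exact hx hw
  have hnot : ¬ rs {x} ≤ rs (tolNbhd R y)ᶜ := by
    intro h
    exact hN y (h.2 ⟨x, hs hxy, rfl⟩)
  obtain ⟨j, m, hjx, hbm, hjm, hall⟩ := hsplit _ _ hnot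
  obtain ⟨Y, rfl⟩ := hrs j
  obtain ⟨M, rfl⟩ := hrs m
  have hYl : lowerApprox R Y = ∅ := Set.subset_eq_empty (hxl ▸ hjx.1) rfl
  have hYM : ¬ upperApprox R Y ⊆ upperApprox R M := by
    intro h
    exact hjm ⟨by change lowerApprox R Y ⊆ _; rw [hYl]; exact Set.empty_subset _, h⟩
  have hyY : y ∈ upperApprox R Y := by
    by_contra hcon
    refine hjm ((hmono Y (tolNbhd R y)ᶜ ?_).trans hbm)
    intro t ht ht'
    exact hcon ⟨t, ht', ht⟩
  obtain ⟨t, htY, htM⟩ := Set.not_subset.1 hYM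
  obtain ⟨z, htz, hzY⟩ := htY
  have hzM : ¬ rs {z} ≤ rs M := by
    intro h
    exact htM (h.2 ⟨z, htz, rfl⟩)
  have hYz : upperApprox R Y ⊆ upperApprox R {z} := ((hall (rs {z})).resolve_left hzM).2
  have hzY' : upperApprox R {z} ⊆ upperApprox R Y :=
    (hmono {z} Y (Set.singleton_subset_iff.2 hzY)).2
  have hup : ∀ w, w ∈ upperApprox R {z} ↔ R z w := by
    intro w
    constructor
    · rintro ⟨q, hq, rfl⟩
      exact hs hq
    · intro h
      exact ⟨z, hs h, rfl⟩
  have hzx : R z x := by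
    obtain ⟨q, hq, hqx⟩ := hjx.2 (hzY' ((hup z).2 (hr z)))
    have : q = x := hqx
    subst this
    exact hq
  have hzy : R z y := (hup y).1 (hYz hyY)
  have hzt : R z t := hs htz
  have key : ∀ u, R z u → tolNbhd R t ⊆ tolNbhd R u := by
    intro u hu
    by_contra hcon
    have h3 := hN2 u t hcon
    rcases hall (rs (tolNbhd R u)ᶜ) with h | h
    · exact htM (h.2 h3)
    · exact hN u (h.2 (hzY' ((hup u).2 hu)))
  refine ⟨z, ?_, hzx, hzy⟩
  intro u hu v hv
  have h4 : R v t := key v hv (hr t)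
  exact key u hu (hs h4)

theorem aux_cover {U : Type u} (R : U → U → Prop) (hR : Tolerance R)
    (h : ∀ x y : U, R x y → ∃ d, IsPreblock R (tolNbhd R d) ∧ R d x ∧ R d y) :
    ∃ H : Set (Set U), IsIrredundantCovering H ∧ InducedBy R H := by
  obtain ⟨hr, hs⟩ := hR
  refine ⟨{B | ∃ d, IsPreblock R (tolNbhd R d) ∧ B = tolNbhd R d}, ⟨⟨?_, ?_⟩, ?_⟩, ?_⟩
  · rintro _ ⟨d, -, rfl⟩
    exact ⟨d, hr d⟩
  · refine Set.eq_univ_of_forall fun x => ?_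
    obtain ⟨d, hd, hdx, -⟩ := h x x (hr x)
    exact ⟨_, ⟨d, hd, rfl⟩, hdx⟩
  · rintro _ ⟨d, hd, rfl⟩ ⟨-, hc⟩
    have hdm : d ∈ ⋃₀ ({B | ∃ d, IsPreblock R (tolNbhd R d) ∧ B = tolNbhd R d} \ {tolNbhd R d}) := by
      rw [hc]; trivial
    obtain ⟨_, ⟨⟨e, he, rfl⟩, hne⟩, hde⟩ := hdm
    apply hne
    change tolNbhd R e = tolNbhd R d
    have hed : R e d := hde
    ext w
    exact ⟨fun hw => he d hed w hw, fun hw => hd e (hs hed) w hw⟩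
  · intro x y
    constructor
    · intro hxy
      obtain ⟨d, hd, hdx, hdy⟩ := h x y hxy
      exact ⟨_, ⟨d, hd, rfl⟩, hdx, hdy⟩
    · rintro ⟨_, ⟨d, hd, rfl⟩, hx, hy⟩
      exact hd x hx y hy

theorem aux_backward {U : Type u} (R : U → U → Prop)
    (H : Set (Set U)) (hH : IsIrredundantCovering H) (hI : InducedBy R H) :
    ∃ (L : Type u) (inst : CompletelyDistribLattice L),
       haveI := inst
       IsCompactlyGenerated L ∧ Nonempty (↥(RSpairs R) ≃o L) := by
  obtain ⟨⟨hne, hcov⟩, hirr⟩ := hH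
  have hpt : ∀ B : H, ∃ x, x ∈ B.1 ∧ ∀ C : H, x ∈ C.1 → C = B := by
    intro B
    by_contra hcon
    push Not at hcon
    refine hirr B.1 B.2 ⟨fun X hX => hne X hX.1, Set.eq_univ_of_forall fun x => ?_⟩
    have hx : x ∈ ⋃₀ H := by rw [hcov]; trivial
    obtain ⟨C, hC, hxC⟩ := hx
    by_cases hCB : C = B.1
    · subst hCB
      obtain ⟨D, hxD, hD⟩ := hcon x hxC
      exact ⟨D.1, ⟨D.2, fun h => hD (Subtype.ext h)⟩, hxD⟩
    · exact ⟨C, ⟨hC, hCB⟩, hxC⟩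
  choose p hpB hpu using hpt
  have hcov' : ∀ x, ∃ B : H, x ∈ B.1 := by
    intro x
    have hx : x ∈ ⋃₀ H := by rw [hcov]; trivial
    obtain ⟨C, hC, hxC⟩ := hx
    exact ⟨⟨C, hC⟩, hxC⟩
  have hlow : ∀ X x, x ∈ lowerApprox R X ↔ ∀ B : H, x ∈ B.1 → B.1 ⊆ X := by
    intro X x
    constructor
    · intro h B hx y hy
      exact h ((hI x y).2 ⟨B.1, B.2, hx, hy⟩)
    · intro h y hy
      obtain ⟨B, hB, hx, hy⟩ := (hI x y).1 hy
      exact h ⟨B, hB⟩ hx hy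
  have hupp : ∀ X x, x ∈ upperApprox R X ↔ ∃ B : H, x ∈ B.1 ∧ (B.1 ∩ X).Nonempty := by
    intro X x
    constructor
    · rintro ⟨y, hy, hyX⟩
      obtain ⟨B, hB, hx, hy⟩ := (hI x y).1 hy
      exact ⟨⟨B, hB⟩, hx, y, hy, hyX⟩
    · rintro ⟨B, hx, y, hy, hyX⟩
      exact ⟨y, (hI x y).2 ⟨B.1, B.2, hx, hy⟩, hyX⟩
  have hlowp : ∀ X (B : H), p B ∈ lowerApprox R X ↔ B.1 ⊆ X := by
    intro X B
    rw [hlow]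
    constructor
    · intro h
      exact h B (hpB B)
    · intro h C hC
      rw [hpu B C hC]
      exact h
  have huppp : ∀ X (B : H), p B ∈ upperApprox R X ↔ (B.1 ∩ X).Nonempty := by
    intro X B
    rw [hupp]
    constructor
    · rintro ⟨C, hC, h⟩
      rw [hpu B C hC] at h
      exact h
    · intro h
      exact ⟨B, hpB B, h⟩
  let f : ↥(RSpairs R) → Set (H ⊕ H) := fun q =>
    Sum.inl '' {B | p B ∈ q.1.1} ∪ Sum.inr '' {B | p B ∈ q.1.2}
  have hfl : ∀ q B, Sum.inl B ∈ f q ↔ p B ∈ q.1.1 := by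
    intro q B; simp [f]
  have hfr : ∀ q B, Sum.inr B ∈ f q ↔ p B ∈ q.1.2 := by
    intro q B; simp [f]
  let r : H ⊕ H → H ⊕ H → Prop := fun a b =>
    (∃ B C : H, (B.1 ∩ C.1).Nonempty ∧ a = Sum.inr C ∧ b = Sum.inl B) ∨
    (∃ B : H, B.1 ⊆ {p B} ∧ a = Sum.inl B ∧ b = Sum.inr B)
  refine aux_ring r f ?_ ?_ ?_
  · rintro ⟨_, X, rfl⟩ ⟨_, Y, rfl⟩
    constructor
    · intro h
      constructor
      · intro x hx
        change x ∈ lowerApprox R Y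
        replace hx : x ∈ lowerApprox R X := hx
        rw [hlow] at hx ⊢
        intro B hB
        rw [← hlowp]
        exact (hfl _ _).1 (h ((hfl _ _).2 ((hlowp X B).2 (hx B hB))))
      · intro x hx
        change x ∈ upperApprox R Y
        replace hx : x ∈ upperApprox R X := hx
        rw [hupp] at hx ⊢
        obtain ⟨B, hB, hBX⟩ := hx
        refine ⟨B, hB, ?_⟩
        rw [← huppp]
        exact (hfr _ _).1 (h ((hfr _ _).2 ((huppp X B).2 hBX)))
    · rintro ⟨h1, h2⟩ (B | B) hB
      · exact (hfl _ _).2 (h1 ((hfl _ _).1 hB))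
      · exact (hfr _ _).2 (h2 ((hfr _ _).1 hB))
  · rintro ⟨_, X, rfl⟩ a b (⟨B, C, ⟨w, hwB, hwC⟩, rfl, rfl⟩ | ⟨B, hB, rfl, rfl⟩) hb
    · rw [hfl] at hb
      rw [hfr]
      exact (huppp X C).2 ⟨w, hwC, (hlowp X B).1 hb hwB⟩
    · rw [hfr] at hb
      rw [hfl]
      obtain ⟨w, hw, hwX⟩ := (huppp X B).1 hb
      refine (hlowp X B).2 fun v hv => ?_
      have h1 : w = p B := hB hw
      have h2 : v = p B := hB hv
      rw [h2, ← h1]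
      exact hwX
  · intro S hS
    have hS1 : ∀ B C : H, (B.1 ∩ C.1).Nonempty → Sum.inl B ∈ S → Sum.inr C ∈ S :=
      fun B C h => hS _ _ (Or.inl ⟨B, C, h, rfl, rfl⟩)
    have hS2 : ∀ B : H, B.1 ⊆ {p B} → Sum.inr B ∈ S → Sum.inl B ∈ S :=
      fun B h => hS _ _ (Or.inr ⟨B, h, rfl, rfl⟩)
    let V : Set U := {x | ∃ B : H, Sum.inl B ∈ S ∧ x ∈ B.1}
    let X : Set U := V ∪ {x | ∃ B : H, Sum.inr B ∈ S ∧ ¬ B.1 ⊆ insert (p B) V ∧ x = p B}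
    refine ⟨⟨_, X, rfl⟩, ?_⟩
    have hXB : ∀ (B : H) x, x ∈ B.1 → x ∈ X →
        x ∈ V ∨ (x = p B ∧ Sum.inr B ∈ S ∧ ¬ B.1 ⊆ insert (p B) V) := by
      rintro B x hxB (hx | ⟨C, hC, hC', rfl⟩)
      · exact Or.inl hx
      · have := hpu C B hxB
        subst this
        exact Or.inr ⟨rfl, hC, hC'⟩
    ext (B | B)
    · rw [hfl]
      refine (hlowp X B).trans ⟨fun h => ?_, fun h x hx => Or.inl ⟨B, h, hx⟩⟩
      rcases hXB B (p B) (hpB B) (h (hpB B)) with ⟨C, hC, hBC⟩ | ⟨-, hB, hB'⟩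
      · rw [hpu B C hBC] at hC
        exact hC
      · exfalso
        apply hB'
        intro x hx
        rcases hXB B x hx (h hx) with h' | ⟨h', -⟩
        · exact Or.inr h'
        · exact Or.inl h'
    · rw [hfr]
      refine (huppp X B).trans ⟨?_, fun h => ?_⟩
      · rintro ⟨x, hxB, hxX⟩
        rcases hXB B x hxB hxX with ⟨C, hC, hxC⟩ | ⟨-, h, -⟩
        · exact hS1 C B ⟨x, hxC, hxB⟩ hC
        · exact h
      · by_cases hB : B.1 ⊆ insert (p B) V
        · by_cases hB1 : B.1 ⊆ {p B}
          · exact ⟨p B, hpB B, Or.inl ⟨B, hS2 B hB1 h, hpB B⟩⟩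
          · obtain ⟨x, hx, hxp⟩ := Set.not_subset.1 hB1
            exact ⟨x, hx, Or.inl ((hB hx).resolve_left hxp)⟩
        · exact ⟨p B, hpB B, Or.inr ⟨B, h, hB, rfl⟩⟩

theorem stmt_13 {U : Type u} (R : U → U → Prop) (hR : Tolerance R) :
    (∃ (L : Type u) (inst : CompletelyDistribLattice L),
       haveI := inst
       IsCompactlyGenerated L ∧ Nonempty (↥(RSpairs R) ≃o L)) ↔
      ∃ H : Set (Set U), IsIrredundantCovering H ∧ InducedBy R H := by
  constructor
  · rintro ⟨L, inst, hc, ⟨e⟩⟩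
    refine aux_cover R hR (aux_forward R hR ?_)
    intro a b hab
    haveI := hc
    obtain ⟨j, m, h1, h2, h3, h4⟩ := aux_split (a := e a) (b := e b) (by simpa using hab)
    refine ⟨e.symm j, e.symm m, ?_, ?_, ?_, ?_⟩
    · rwa [e.symm_apply_le]
    · rwa [e.le_symm_apply]
    · simpa using h3
    · intro c
      rw [e.le_symm_apply, e.symm_apply_le]
      exact h4 (e c)
  · rintro ⟨H, hH, hI⟩
    exact aux_backward R H hH hI
end

section
/- Let R be a tolerance induced by an irredundant covering of a set U. Then RS = {(X^▽, X^△) | X ⊆ U}, ordered coordinatewise, together with the operation ∼(A, B) = (Bᶜ, Aᶜ), is a quasi-Nelson algebra: RS is a bounded distributive lattice with least element (∅, ∅) and greatest element (U, U); ∼ satisfies (K1) ∼∼a = a, (K2) a ≤ b ⟺ ∼b ≤ ∼a, and (K3) a ∧ ∼a ≤ b ∨ ∼b for all a, b ∈ RS; and for all a, b ∈ RS the relative pseudocomplement a ⇒ (∼a ∨ b) exists in RS (i.e., there is a greatest x ∈ RS with a ∧ x ≤ ∼a ∨ b). -/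
open Set

universe u v

def rsMeet {U : Type*} (R : U → U → Prop) (p q : Set U × Set U) : Set U × Set U :=
  (p.1 ∩ q.1, upperApprox R (lowerApprox R (p.2 ∩ q.2)))

def rsJoin {U : Type*} (R : U → U → Prop) (p q : Set U × Set U) : Set U × Set U :=
  (lowerApprox R (upperApprox R (p.1 ∪ q.1)), p.2 ∪ q.2)

def rsNeg {U : Type*} (p : Set U × Set U) : Set U × Set U := ((p.2)ᶜ, (p.1)ᶜ)

section Helpers

variable {U : Type*} {ι : Type*}

def hD (B : ι → Set U) (L : Set ι) : Set U := {x | ∀ i, x ∈ B i → i ∈ L}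

def hO (B : ι → Set U) (M : Set ι) : Set U := {x | ∃ i, x ∈ B i ∧ i ∈ M}

def hphi (B : ι → Set U) (P : Set ι × Set ι) : Set U × Set U := (hD B P.1, hO B P.2)

def hV (B : ι → Set U) (f : ι → U) : Set (Set ι × Set ι) :=
  {P | (∀ i j, i ∈ P.1 → (∃ x, x ∈ B i ∧ x ∈ B j) → j ∈ P.2) ∧
    (∀ i, (∀ x ∈ B i, x = f i) → i ∈ P.2 → i ∈ P.1)}

structure HSys (R : U → U → Prop) (B : ι → Set U) (f : ι → U) : Prop where
  refl : ∀ x, R x x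
  ind : ∀ x y, R x y ↔ ∃ i, x ∈ B i ∧ y ∈ B i
  core : ∀ i j, f i ∈ B j ↔ i = j

variable {R : U → U → Prop} {B : ι → Set U} {f : ι → U}

theorem HSys.mem (h : HSys R B f) (i : ι) : f i ∈ B i := (h.core i i).2 rfl

theorem HSys.cov (h : HSys R B f) (x : U) : ∃ i, x ∈ B i := by
  obtain ⟨i, hi, _⟩ := (h.ind x x).1 (h.refl x)
  exact ⟨i, hi⟩

theorem HSys.lower (h : HSys R B f) (X : Set U) :
    lowerApprox R X = hD B {i | B i ⊆ X} := by
  ext x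
  constructor
  · intro hx i hi y hy
    exact hx ((h.ind x y).2 ⟨i, hi, hy⟩)
  · intro hx y hy
    obtain ⟨i, hi, hy⟩ := (h.ind x y).1 hy
    exact hx i hi hy

theorem HSys.upper (h : HSys R B f) (X : Set U) :
    upperApprox R X = hO B {i | ∃ x ∈ B i, x ∈ X} := by
  ext x
  constructor
  · rintro ⟨y, hy, hX⟩
    obtain ⟨i, hi, hy⟩ := (h.ind x y).1 hy
    exact ⟨i, hi, y, hy, hX⟩
  · rintro ⟨i, hi, y, hy, hX⟩
    exact ⟨y, (h.ind x y).2 ⟨i, hi, hy⟩, hX⟩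

theorem HSys.fD (h : HSys R B f) (L : Set ι) (i : ι) : f i ∈ hD B L ↔ i ∈ L := by
  constructor
  · intro hx
    exact hx i (h.mem i)
  · intro hi j hj
    rwa [← (h.core i j).1 hj]

theorem HSys.fO (h : HSys R B f) (M : Set ι) (i : ι) : f i ∈ hO B M ↔ i ∈ M := by
  constructor
  · rintro ⟨j, hj, hM⟩
    rwa [(h.core i j).1 hj]
  · intro hi
    exact ⟨i, h.mem i, hi⟩

theorem HSys.le_iff (h : HSys R B f) (P Q : Set ι × Set ι) :
    hphi B P ≤ hphi B Q ↔ P ≤ Q := by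
  constructor
  · rintro ⟨h1, h2⟩
    exact ⟨fun i hi => (h.fD _ i).1 (h1 ((h.fD _ i).2 hi)),
      fun i hi => (h.fO _ i).1 (h2 ((h.fO _ i).2 hi))⟩
  · rintro ⟨h1, h2⟩
    exact ⟨fun x hx i hi => h1 (hx i hi), fun x ⟨i, hi, hM⟩ => ⟨i, hi, h2 hM⟩⟩

theorem HSys.meet (h : HSys R B f) (P Q : Set ι × Set ι) :
    rsMeet R (hphi B P) (hphi B Q) = hphi B (P ⊓ Q) := by
  refine Prod.ext ?_ ?_
  · ext x
    exact ⟨fun hx i hi => ⟨hx.1 i hi, hx.2 i hi⟩,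
      fun hx => ⟨fun i hi => (hx i hi).1, fun i hi => (hx i hi).2⟩⟩
  · change upperApprox R (lowerApprox R (hO B P.2 ∩ hO B Q.2)) = hO B (P.2 ∩ Q.2)
    have e1 : {i | B i ⊆ hO B P.2 ∩ hO B Q.2} = P.2 ∩ Q.2 := by
      ext i
      constructor
      · intro hi
        have := hi (h.mem i)
        exact ⟨(h.fO _ i).1 this.1, (h.fO _ i).1 this.2⟩
      · intro hi x hx
        exact ⟨⟨i, hx, hi.1⟩, ⟨i, hx, hi.2⟩⟩
    rw [h.lower, e1, h.upper]
    congr 1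
    ext i
    constructor
    · rintro ⟨x, hx, hD⟩
      exact hD i hx
    · intro hi
      exact ⟨f i, h.mem i, (h.fD _ i).2 hi⟩

theorem HSys.join (h : HSys R B f) (P Q : Set ι × Set ι) :
    rsJoin R (hphi B P) (hphi B Q) = hphi B (P ⊔ Q) := by
  refine Prod.ext ?_ ?_
  · change lowerApprox R (upperApprox R (hD B P.1 ∪ hD B Q.1)) = hD B (P.1 ∪ Q.1)
    have e1 : {i | ∃ x ∈ B i, x ∈ hD B P.1 ∪ hD B Q.1} = P.1 ∪ Q.1 := by
      ext i
      constructor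
      · rintro ⟨x, hx, hD | hD⟩
        · exact Or.inl (hD i hx)
        · exact Or.inr (hD i hx)
      · rintro (hi | hi)
        · exact ⟨f i, h.mem i, Or.inl ((h.fD _ i).2 hi)⟩
        · exact ⟨f i, h.mem i, Or.inr ((h.fD _ i).2 hi)⟩
    rw [h.upper, e1, h.lower]
    congr 1
    ext i
    constructor
    · intro hi
      exact (h.fO _ i).1 (hi (h.mem i))
    · intro hi x hx
      exact ⟨i, hx, hi⟩
  · ext x
    constructor
    · rintro (⟨i, hi, hM⟩ | ⟨i, hi, hM⟩)
      · exact ⟨i, hi, Or.inl hM⟩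
      · exact ⟨i, hi, Or.inr hM⟩
    · rintro ⟨i, hi, hM | hM⟩
      · exact Or.inl ⟨i, hi, hM⟩
      · exact Or.inr ⟨i, hi, hM⟩

theorem hphi_neg (P : Set ι × Set ι) :
    rsNeg (hphi B P) = hphi B (P.2ᶜ, P.1ᶜ) := by
  refine Prod.ext ?_ ?_
  · ext x
    simp [rsNeg, hphi, hD, hO]
  · ext x
    simp [rsNeg, hphi, hD, hO]

theorem HSys.rs (h : HSys R B f) : RSpairs R = hphi B '' hV B f := by
  ext p
  constructor
  · rintro ⟨X, rfl⟩
    refine ⟨({i | B i ⊆ X}, {i | ∃ x ∈ B i, x ∈ X}), ⟨?_, ?_⟩, ?_⟩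
    · rintro i j hi ⟨x, hx, hxj⟩
      exact ⟨x, hxj, hi hx⟩
    · rintro i hs ⟨x, hx, hX⟩ y hy
      rw [hs y hy, ← hs x hx]
      exact hX
    · rw [h.lower, h.upper]
      rfl
  · rintro ⟨⟨L, M⟩, ⟨h1, h2⟩, rfl⟩
    simp only at h1 h2
    refine ⟨hO B L ∪ {x | ∃ i, i ∈ M ∧ x = f i ∧ ∀ y ∈ B i, y ∉ hO B L}, ?_⟩
    rw [h.lower, h.upper]
    refine Prod.ext ?_ ?_
    · change hD B L = _
      congr 1
      ext i
      constructor
      · intro hi x hx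
        exact Or.inl ⟨i, hx, hi⟩
      · intro hi
        rcases hi (h.mem i) with hf | ⟨j, hj, hf, hd⟩
        · exact (h.fO _ i).1 hf
        · have hij : i = j := (h.core i j).1 (hf ▸ h.mem j)
          subst hij
          refine h2 i (fun x hx => ?_) hj
          rcases hi hx with hx' | ⟨k, _, hk, _⟩
          · exact absurd hx' (hd x hx)
          · subst hk
            rw [(h.core k i).1 hx]
    · change hO B M = _
      congr 1
      ext i
      constructor
      · intro hi
        by_cases hc : ∃ y ∈ B i, y ∈ hO B L
        · obtain ⟨y, hy, hyL⟩ := hc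
          exact ⟨y, hy, Or.inl hyL⟩
        · push Not at hc
          exact ⟨f i, h.mem i, Or.inr ⟨i, hi, rfl, hc⟩⟩
      · rintro ⟨x, hx, ⟨j, hj, hjL⟩ | ⟨j, hj, rfl, _⟩⟩
        · exact h1 j i hjL ⟨x, hj, hx⟩
        · rwa [← (h.core j i).1 hx]

theorem HSys.sub (h : HSys R B f) {P : Set ι × Set ι} (hP : P ∈ hV B f) : P.1 ⊆ P.2 :=
  fun i hi => hP.1 i i hi ⟨f i, h.mem i, h.mem i⟩

theorem hV_inf {P Q : Set ι × Set ι} (hP : P ∈ hV B f) (hQ : Q ∈ hV B f) : P ⊓ Q ∈ hV B f :=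
  ⟨fun i j hi hx => ⟨hP.1 i j hi.1 hx, hQ.1 i j hi.2 hx⟩,
    fun i hs hi => ⟨hP.2 i hs hi.1, hQ.2 i hs hi.2⟩⟩

theorem hV_sSup {S : Set (Set ι × Set ι)} (hS : S ⊆ hV B f) :
    ((⋃ P ∈ S, P.1, ⋃ P ∈ S, P.2) : Set ι × Set ι) ∈ hV B f := by
  constructor
  · intro i j hi hx
    simp only [mem_iUnion] at hi ⊢
    obtain ⟨P, hP, hi⟩ := hi
    exact ⟨P, hP, (hS hP).1 i j hi hx⟩
  · intro i hs hi
    simp only [mem_iUnion] at hi ⊢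
    obtain ⟨P, hP, hi⟩ := hi
    exact ⟨P, hP, (hS hP).2 i hs hi⟩

theorem hV_sup {P Q : Set ι × Set ι} (hP : P ∈ hV B f) (hQ : Q ∈ hV B f) : P ⊔ Q ∈ hV B f :=
  ⟨fun i j hi hx => hi.imp (fun a => hP.1 i j a hx) (fun a => hQ.1 i j a hx),
    fun i hs hi => hi.imp (hP.2 i hs) (hQ.2 i hs)⟩

theorem hV_neg {P : Set ι × Set ι} (hP : P ∈ hV B f) : (P.2ᶜ, P.1ᶜ) ∈ hV B f :=
  ⟨fun i j hi ⟨x, hx, hy⟩ hj => hi (hP.1 j i hj ⟨x, hy, hx⟩),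
    fun i hs hi hj => hi (hP.2 i hs hj)⟩

theorem exists_HSys (R : U → U → Prop) (hR : Tolerance R)
    (H : Set (Set U)) (hH : IsIrredundantCovering H) (hind : InducedBy R H) :
    ∃ f : ↥H → U, HSys R (fun b : ↥H => (b : Set U)) f := by
  have key : ∀ b : ↥H, ∃ x, x ∈ (b : Set U) ∧ ∀ c ∈ H, x ∈ c → c = b := by
    rintro ⟨b, hb⟩
    by_contra! hc
    refine hH.2 b hb ⟨fun X hX => hH.1.1 X hX.1, ?_⟩
    refine eq_univ_of_forall fun x => ?_
    have hx : x ∈ ⋃₀ H := hH.1.2 ▸ mem_univ x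
    obtain ⟨c, hcH, hxc⟩ := hx
    by_cases hcb : c = b
    · obtain ⟨d, hd, hxd, hne⟩ := hc x (hcb ▸ hxc)
      exact ⟨d, ⟨hd, hne⟩, hxd⟩
    · exact ⟨c, ⟨hcH, hcb⟩, hxc⟩
  choose f hf1 hf2 using key
  refine ⟨f, hR.1, fun x y => ?_, fun i j => ⟨fun hx => ?_, fun hx => hx ▸ hf1 i⟩⟩
  · rw [hind]
    exact ⟨fun ⟨b, hb, hxy⟩ => ⟨⟨b, hb⟩, hxy⟩, fun ⟨b, hxy⟩ => ⟨b, b.2, hxy⟩⟩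
  · exact Subtype.ext (hf2 i j j.2 hx).symm

end Helpers

theorem stmt_14 {U : Type*} (R : U → U → Prop) (hR : Tolerance R)
    (H : Set (Set U)) (hH : IsIrredundantCovering H) (hind : InducedBy R H) :
    -- bounds
    (((∅, ∅) : Set U × Set U) ∈ RSpairs R ∧ ((Set.univ, Set.univ) : Set U × Set U) ∈ RSpairs R ∧
      ∀ p ∈ RSpairs R, ((∅, ∅) : Set U × Set U) ≤ p ∧ p ≤ ((Set.univ, Set.univ) : Set U × Set U)) ∧
    -- closure under the operations
    (∀ p ∈ RSpairs R, ∀ q ∈ RSpairs R,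
      rsMeet R p q ∈ RSpairs R ∧ rsJoin R p q ∈ RSpairs R ∧ rsNeg p ∈ RSpairs R) ∧
    -- rsMeet is the infimum in RS
    (∀ p ∈ RSpairs R, ∀ q ∈ RSpairs R, rsMeet R p q ≤ p ∧ rsMeet R p q ≤ q ∧
      ∀ r ∈ RSpairs R, r ≤ p → r ≤ q → r ≤ rsMeet R p q) ∧
    -- rsJoin is the supremum in RS
    (∀ p ∈ RSpairs R, ∀ q ∈ RSpairs R, p ≤ rsJoin R p q ∧ q ≤ rsJoin R p q ∧
      ∀ r ∈ RSpairs R, p ≤ r → q ≤ r → rsJoin R p q ≤ r) ∧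
    -- distributivity
    (∀ p ∈ RSpairs R, ∀ q ∈ RSpairs R, ∀ r ∈ RSpairs R,
      rsMeet R p (rsJoin R q r) = rsJoin R (rsMeet R p q) (rsMeet R p r)) ∧
    -- (K1)
    (∀ p ∈ RSpairs R, rsNeg (rsNeg p) = p) ∧
    -- (K2)
    (∀ p ∈ RSpairs R, ∀ q ∈ RSpairs R, (p ≤ q ↔ rsNeg q ≤ rsNeg p)) ∧
    -- (K3)
    (∀ p ∈ RSpairs R, ∀ q ∈ RSpairs R, rsMeet R p (rsNeg p) ≤ rsJoin R q (rsNeg q)) ∧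
    -- weak relative pseudocomplement a → b = a ⇒ (∼a ∨ b) exists
    (∀ p ∈ RSpairs R, ∀ q ∈ RSpairs R, ∃ w ∈ RSpairs R,
      ∀ x ∈ RSpairs R, (rsMeet R p x ≤ rsJoin R (rsNeg p) q ↔ x ≤ w)) := by
  obtain ⟨f, h⟩ := exists_HSys R hR H hH hind
  rw [h.rs]
  simp only [forall_mem_image, exists_mem_image, h.meet, h.join, hphi_neg, h.le_iff]
  have hmem : ∀ {P}, P ∈ hV (fun b : ↥H => (b : Set U)) f →
    hphi (fun b : ↥H => (b : Set U)) P ∈ hphi (fun b : ↥H => (b : Set U)) '' hV _ f :=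
    fun hP => mem_image_of_mem _ hP
  refine ⟨⟨?_, ?_, ?_⟩, ?_, ?_, ?_, ?_, ?_, ?_, ?_, ?_⟩
  · rw [← h.rs]
    refine ⟨∅, ?_⟩
    refine Prod.ext ?_ ?_
    · refine (eq_empty_of_forall_notMem fun x hx => ?_).symm
      exact hx (hR.1 x)
    · refine (eq_empty_of_forall_notMem fun x hx => ?_).symm
      obtain ⟨y, _, hy⟩ := hx
      exact hy
  · rw [← h.rs]
    refine ⟨univ, ?_⟩
    refine Prod.ext ?_ ?_
    · exact (eq_univ_of_forall fun x => subset_univ _).symm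
    · refine (eq_univ_of_forall fun x => ?_).symm
      exact ⟨x, hR.1 x, mem_univ x⟩
  · intro P _
    exact ⟨⟨empty_subset _, empty_subset _⟩, ⟨subset_univ _, subset_univ _⟩⟩
  · intro P hP Q hQ
    exact ⟨hmem (hV_inf hP hQ), hmem (hV_sup hP hQ), hmem (hV_neg hP)⟩
  · intro P _ Q _
    exact ⟨inf_le_left, inf_le_right, fun S _ h1 h2 => le_inf h1 h2⟩
  · intro P _ Q _
    exact ⟨le_sup_left, le_sup_right, fun S _ h1 h2 => sup_le h1 h2⟩
  · intro P _ Q _ S _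
    rw [inf_sup_left]
  · intro P _
    simp
  · intro P _ Q _
    constructor
    · rintro ⟨h1, h2⟩
      exact ⟨compl_subset_compl.2 h2, compl_subset_compl.2 h1⟩
    · rintro ⟨h1, h2⟩
      exact ⟨compl_subset_compl.1 h2, compl_subset_compl.1 h1⟩
  · intro P hP Q hQ
    constructor
    · rintro i ⟨h1, h2⟩
      exact absurd (h.sub hP h1) h2
    · rintro i _
      by_cases hi : i ∈ Q.1
      · exact Or.inl (h.sub hQ hi)
      · exact Or.inr hi
  · intro P hP Q hQ
    refine ⟨_, hV_sSup (S := {T | T ∈ hV (fun b : ↥H => (b : Set U)) f ∧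
      P ⊓ T ≤ ((P.2ᶜ, P.1ᶜ) : Set ↥H × Set ↥H) ⊔ Q}) (fun T hT => hT.1), ?_⟩
    intro T hT
    constructor
    · intro hle
      exact ⟨fun i hi => mem_iUnion₂.2 ⟨T, ⟨hT, hle⟩, hi⟩,
        fun i hi => mem_iUnion₂.2 ⟨T, ⟨hT, hle⟩, hi⟩⟩
    · rintro ⟨h1, h2⟩
      constructor
      · rintro i ⟨hi, hi'⟩
        obtain ⟨S, hS, hiS⟩ := mem_iUnion₂.1 (h1 hi')
        exact hS.2.1 ⟨hi, hiS⟩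
      · rintro i ⟨hi, hi'⟩
        obtain ⟨S, hS, hiS⟩ := mem_iUnion₂.1 (h2 hi')
        exact hS.2.2 ⟨hi, hiS⟩
end

section
/- Let R be a tolerance on a set U. If for every X ⊆ U with |X| = 5 the ordered set RS_X of rough sets determined by the restriction R_X of R to X (ordered coordinatewise by inclusion) is a lattice, then R satisfies condition (C): for any R-path (a₀, a₁, a₂, a₃, a₄) of length 4 there exist 0 ≤ i, j ≤ 4 with |i − j| ≥ 2 and a_i R a_j. -/
open Set

universe u v

/-- Adjacency (reflexive) of the path on five vertices. -/
def pathAdj (i j : Fin 5) : Prop := (i : ℕ) ≤ j + 1 ∧ (j : ℕ) ≤ i + 1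

instance (i j : Fin 5) : Decidable (pathAdj i j) := by unfold pathAdj; infer_instance

def pullSet {V : Type*} (e : Fin 5 ≃ V) (T : Finset (Fin 5)) : Set V := {x | e.symm x ∈ T}

theorem mem_lower_pull {V : Type*} (r : V → V → Prop) (e : Fin 5 ≃ V)
    (hr : ∀ i j, r (e i) (e j) ↔ pathAdj i j) (S : Set V) (i : Fin 5) :
    e i ∈ lowerApprox r S ↔ ∀ j, pathAdj i j → e j ∈ S := by
  simp only [lowerApprox, tolNbhd, Set.mem_ofPred_eq, Set.subset_def]
  rw [e.surjective.forall]
  simp only [hr]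

theorem mem_upper_pull {V : Type*} (r : V → V → Prop) (e : Fin 5 ≃ V)
    (hr : ∀ i j, r (e i) (e j) ↔ pathAdj i j) (S : Set V) (i : Fin 5) :
    e i ∈ upperApprox r S ↔ ∃ j, pathAdj i j ∧ e j ∈ S := by
  simp only [upperApprox, tolNbhd, Set.mem_ofPred_eq, Set.Nonempty, Set.mem_inter_iff]
  rw [e.surjective.exists]
  simp only [hr]

theorem pull_le {V : Type*} (r : V → V → Prop) (e : Fin 5 ≃ V)
    (hr : ∀ i j, r (e i) (e j) ↔ pathAdj i j) (S T : Finset (Fin 5))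
    (h1 : ∀ i, (∀ j, pathAdj i j → j ∈ S) → (∀ j, pathAdj i j → j ∈ T))
    (h2 : ∀ i, (∃ j, pathAdj i j ∧ j ∈ S) → (∃ j, pathAdj i j ∧ j ∈ T)) :
    (lowerApprox r (pullSet e S), upperApprox r (pullSet e S)) ≤
      (lowerApprox r (pullSet e T), upperApprox r (pullSet e T)) := by
  refine ⟨?_, ?_⟩
  · intro x
    obtain ⟨i, rfl⟩ := e.surjective x
    simp only [mem_lower_pull r e hr]
    simpa [pullSet] using h1 i
  · intro x
    obtain ⟨i, rfl⟩ := e.surjective x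
    simp only [mem_upper_pull r e hr]
    simpa [pullSet] using h2 i

theorem no_lub {V : Type*} (r : V → V → Prop) (e : Fin 5 ≃ V)
    (hr : ∀ i j, r (e i) (e j) ↔ pathAdj i j)
    (h : ∀ p q : ↥(RSpairs r), ∃ s, IsLUB {p, q} s) : False := by
  let pt : Finset (Fin 5) → ↥(RSpairs r) := fun T => ⟨_, pullSet e T, rfl⟩
  obtain ⟨⟨s, S, rfl⟩, hub, hl⟩ := h (pt {2}) (pt {0, 1})
  have hA := hub (a := pt {2}) (by simp)
  have hB := hub (a := pt {0, 1}) (by simp)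
  have hC := hl (a := pt {0, 1, 2}) (by
    rintro x (rfl | rfl)
    · exact pull_le r e hr _ _ (by decide) (by decide)
    · exact pull_le r e hr _ _ (by decide) (by decide))
  have hD := hl (a := pt {0, 1, 3}) (by
    rintro x (rfl | rfl)
    · exact pull_le r e hr _ _ (by decide) (by decide)
    · exact pull_le r e hr _ _ (by decide) (by decide))
  have b0 : e 0 ∈ lowerApprox r S := hB.1 (by
    rw [mem_lower_pull r e hr]; simp only [pullSet, Set.mem_ofPred_eq, e.symm_apply_apply]; decide)
  have a3 : e 3 ∈ upperApprox r S := hA.2 (by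
    rw [mem_upper_pull r e hr]; simp only [pullSet, Set.mem_ofPred_eq, e.symm_apply_apply]; decide)
  have c4 : e 4 ∉ upperApprox r S := fun hh => by
    have := hC.2 hh
    rw [mem_upper_pull r e hr] at this
    simp only [pullSet, Set.mem_ofPred_eq, e.symm_apply_apply] at this
    revert this; decide
  have d1 : e 1 ∉ lowerApprox r S := fun hh => by
    have := hD.1 hh
    rw [mem_lower_pull r e hr] at this
    simp only [pullSet, Set.mem_ofPred_eq, e.symm_apply_apply] at this
    revert this; decide
  rw [mem_lower_pull r e hr] at b0 d1
  rw [mem_upper_pull r e hr] at a3 c4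
  have s0 := b0 0 (by decide)
  have s1 := b0 1 (by decide)
  have s3 : e 3 ∉ S := fun hh => c4 ⟨3, by decide, hh⟩
  have s4 : e 4 ∉ S := fun hh => c4 ⟨4, by decide, hh⟩
  have s2 : e 2 ∈ S := by
    obtain ⟨j, hj, hS⟩ := a3
    fin_cases j
    · exact absurd hj (by decide)
    · exact absurd hj (by decide)
    · exact hS
    · exact absurd hS s3
    · exact absurd hS s4
  apply d1
  intro j hj
  fin_cases j
  · exact s0
  · exact s1
  · exact s2
  · exact absurd hj (by decide)
  · exact absurd hj (by decide)

theorem stmt_15 {U : Type*} (R : U → U → Prop) (hR : Tolerance R)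
    (h : ∀ X : Set U, X.ncard = 5 →
      ∀ p q : ↥(RSpairs (restrictRel R X)),
        (∃ s, IsLUB {p, q} s) ∧ (∃ s, IsGLB {p, q} s)) :
    CondC R := by
  intro a ha hp
  by_contra hc
  have hcard : (Set.range a).ncard = 5 := by
    rw [← Set.image_univ, Set.ncard_image_of_injective _ ha, Set.ncard_univ]; simp
  refine no_lub (restrictRel R (Set.range a)) (Equiv.ofInjective a ha) ?_
    (fun p q => (h _ hcard p q).1)
  intro i j
  change R (a i) (a j) ↔ _
  constructor
  · intro hij
    by_contra hn
    refine hc ⟨i, j, ?_, hij⟩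
    unfold pathAdj at hn
    omega
  · have h0 : R (a 0) (a 1) := hp 0
    have h1 : R (a 1) (a 2) := hp 1
    have h2 : R (a 2) (a 3) := hp 2
    have h3 : R (a 3) (a 4) := hp 3
    intro hij
    fin_cases i <;> fin_cases j <;>
      first
      | exact absurd hij (by decide)
      | exact hR.1 _
      | assumption
      | (apply hR.2; assumption)
end

section
/- Let R be a tolerance on a set U satisfying condition (C): for any R-path (a₀, a₁, a₂, a₃, a₄) of length 4 there exist 0 ≤ i, j ≤ 4 with |i − j| ≥ 2 and a_i R a_j. Then RS = {(X^▽, X^△) | X ⊆ U}, ordered coordinatewise by inclusion, is a complete lattice; in particular, for every family {X_i}_{i∈I} of subsets of U there exists Z ⊆ U with Z^▽ = ⋂_i X_i^▽ and Z^△ = (⋂_i X_i^△)^{▽△}. -/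
open Set

universe u v

theorem aux_maxindep {U : Type u} (R : U → U → Prop) (hs : Symmetric R) (E : Set U) :
    ∃ M ⊆ E, (∀ x ∈ M, ∀ y ∈ M, x ≠ y → ¬ R x y) ∧
      (∀ x ∈ E, x ∈ M ∨ ∃ m ∈ M, R x m) := by
  have hz := zorn_subset {M : Set U | M ⊆ E ∧ ∀ x ∈ M, ∀ y ∈ M, x ≠ y → ¬ R x y} (by
    intro c hc hch
    refine ⟨⋃₀ c, ⟨?_, ?_⟩, fun s hs => subset_sUnion_of_mem hs⟩
    · exact sUnion_subset fun s hs => (hc hs).1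
    · rintro x ⟨s, hsc, hxs⟩ y ⟨t, htc, hyt⟩ hne
      rcases hch.total hsc htc with h | h
      · exact (hc htc).2 x (h hxs) y hyt hne
      · exact (hc hsc).2 x hxs y (h hyt) hne)
  obtain ⟨M, hM⟩ := hz
  refine ⟨M, hM.prop.1, hM.prop.2, ?_⟩
  intro x hx
  by_contra hcon
  push Not at hcon
  obtain ⟨hxM, hn⟩ := hcon
  apply hxM
  have : insert x M ⊆ M := by
    apply hM.le_of_ge _ (subset_insert x M)
    refine ⟨insert_subset hx hM.prop.1, ?_⟩
    rintro u (rfl | hu) v (rfl | hv) hne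
    · exact absurd rfl hne
    · exact hn v hv
    · exact fun h => hn u hu (hs h)
    · exact hM.prop.2 u hu v hv hne
  exact this (mem_insert x M)

theorem aux_path {U : Type u} (R : U → U → Prop) (hr : Reflexive R) (hs : Symmetric R)
    (hC : CondC R) (a b c d e : U)
    (hab : R a b) (hbc : R b c) (hcd : R c d) (hde : R d e)
    (hac : ¬ R a c) (had : ¬ R a d) (hae : ¬ R a e) (hbd : ¬ R b d) (hbe : ¬ R b e)
    (hce : ¬ R c e) : False := by
  have hsym : ∀ {x y}, ¬ R x y → ¬ R y x := fun h h' => h (hs h')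
  have hne : ∀ {x y}, ¬ R x y → x ≠ y := fun h h' => h (h' ▸ hr _)
  have h1 : a ≠ b := fun h => hac (h ▸ hbc)
  have h2 : b ≠ c := fun h => hac (h ▸ hab)
  have h3 : c ≠ d := fun h => hbd (h ▸ hbc)
  have h4 : d ≠ e := fun h => hce (h ▸ hcd)
  have hinj : Function.Injective ![a, b, c, d, e] := by
    intro i j hij
    have := hne hac
    have := hne had
    have := hne hae
    have := hne hbd
    have := hne hbe
    have := hne hce
    fin_cases i <;> fin_cases j <;> simp_all
  obtain ⟨i, j, hij, h⟩ := hC ![a, b, c, d, e] hinj (by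
    intro i
    fin_cases i <;> simpa)
  have := hsym hac
  have := hsym had
  have := hsym hae
  have := hsym hbd
  have := hsym hbe
  have := hsym hce
  fin_cases i <;> fin_cases j <;> simp_all

theorem aux_key_s16 {U : Type u} (R : U → U → Prop) (hR : Tolerance R) (hC : CondC R)
    (ι : Type u) (X : ι → Set U) : ∃ Z : Set U,
      lowerApprox R Z = ⋂ i, lowerApprox R (X i) ∧
      upperApprox R Z = upperApprox R (lowerApprox R (⋂ i, upperApprox R (X i))) := by
  obtain ⟨hr, hs⟩ := hR
  obtain ⟨A, hA⟩ : ∃ A, A = ⋂ i, lowerApprox R (X i) := ⟨_, rfl⟩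
  obtain ⟨B, hB⟩ : ∃ B, B = ⋂ i, upperApprox R (X i) := ⟨_, rfl⟩
  obtain ⟨D, hD⟩ : ∃ D, D = lowerApprox R B := ⟨_, rfl⟩
  rw [← hA, ← hB, ← hD]
  have mA : ∀ x, x ∈ A ↔ ∀ i, ∀ y, R x y → y ∈ X i := by
    intro x; rw [hA, mem_iInter]; rfl
  have mB : ∀ x, x ∈ B ↔ ∀ i, ∃ y, R x y ∧ y ∈ X i := by
    intro x; rw [hB, mem_iInter]; rfl
  have mD : ∀ x, x ∈ D ↔ ∀ y, R x y → y ∈ B := by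
    intro x; rw [hD]; rfl
  let P : Set U := {x | ∃ a ∈ A, R a x}
  let D' : Set U := {x | ∀ y, R x y → y ∈ D}
  have hPD : ∀ x ∈ P, x ∈ D := by
    rintro x ⟨a, ha, hax⟩
    rw [mD]
    intro y hxy
    rw [mB]
    intro i
    exact ⟨x, hs hxy, (mA a).1 ha i x hax⟩
  let S : Set U := {z | z ∉ P ∧ ∃ x ∈ P, x ∉ A ∧ x ∈ D' ∧ R x z}
  obtain ⟨M, hME, hMi, hMm⟩ := aux_maxindep R hs
    {x | x ∈ D' ∧ x ∉ P ∧ ∀ z ∈ S, ¬ R x z}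
  have hST : ∀ z ∈ S, ∀ y, y ∉ D → R z y → False := by
    rintro z ⟨hzP, x, ⟨a, ha, hax⟩, hxA, hxD', hxz⟩ y hy hzy
    have hyD := hy
    rw [mD] at hy
    push Not at hy
    obtain ⟨v, hyv, hvB⟩ := hy
    have hzD : z ∈ D := hxD' z hxz
    have hxD : x ∈ D := hxD' x (hr x)
    have haD : a ∈ D := hPD a ⟨a, ha, hr a⟩
    exact aux_path R hr hs hC a x z y v hax hxz hzy hyv
      (fun h => hzP ⟨a, ha, h⟩) (fun h => hyD (hPD y ⟨a, ha, h⟩))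
      (fun h => hvB ((mD a).1 haD v h)) (fun h => hyD (hxD' y h))
      (fun h => hvB ((mD x).1 hxD v h)) (fun h => hvB ((mD z).1 hzD v h))
  have hZP : ∀ x ∈ P, x ∈ D \ (S ∪ M) := by
    intro x hx
    refine ⟨hPD x hx, ?_⟩
    rintro (h | h)
    · exact h.1 hx
    · exact (hME h).2.1 hx
  refine ⟨D \ (S ∪ M), ?_, ?_⟩
  · apply Subset.antisymm
    · intro x hx
      have hx' : ∀ y, R x y → y ∈ D \ (S ∪ M) := hx
      have hxD' : x ∈ D' := fun y h => (hx' y h).1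
      by_contra hxA
      by_cases hxP : x ∈ P
      · have h := hxA
        rw [mA] at h
        push Not at h
        obtain ⟨i, z, hxz, hz⟩ := h
        refine (hx' z hxz).2 (Or.inl ⟨?_, x, hxP, hxA, hxD', hxz⟩)
        rintro ⟨a, ha, haz⟩
        exact hz ((mA a).1 ha i z haz)
      · by_cases h : ∀ z ∈ S, ¬ R x z
        · rcases hMm x ⟨hxD', hxP, h⟩ with h | ⟨m, hm, hxm⟩
          · exact (hx' x (hr x)).2 (Or.inr h)
          · exact (hx' m hxm).2 (Or.inr hm)
        · push Not at h
          obtain ⟨z, hz, hxz⟩ := h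
          exact (hx' z hxz).2 (Or.inl hz)
    · intro x hx y hxy
      exact hZP y ⟨x, hx, hxy⟩
  · apply Subset.antisymm
    · rintro y ⟨z, hyz, hz⟩
      exact ⟨z, hyz, hz.1⟩
    · rintro y ⟨z, hyz, hz⟩
      have hyz : R y z := hyz
      by_cases hp : ∃ p ∈ P, R y p
      · obtain ⟨p, hp, hyp⟩ := hp
        exact ⟨p, hyp, hZP p hp⟩
      by_cases hyD : y ∈ D
      · have hyS : y ∉ S := by
          rintro ⟨_, x, hx, _, _, hxy⟩
          exact hp ⟨x, hx, hs hxy⟩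
        by_cases hyM : y ∈ M
        · obtain ⟨h1, h2, h3⟩ := hME hyM
          by_cases h : ∃ w, R y w ∧ w ≠ y
          · obtain ⟨w, hyw, hne⟩ := h
            refine ⟨w, hyw, h1 w hyw, ?_⟩
            rintro (h | h)
            · exact h3 w h hyw
            · exact hMi y hyM w h hne.symm hyw
          · push Not at h
            exfalso
            apply h2
            refine ⟨y, (mA y).2 ?_, hr y⟩
            intro i w hyw
            obtain ⟨v, hv, hvX⟩ := (mB y).1 ((mD y).1 hyD y (hr y)) i
            rw [h w hyw, ← h v hv]
            exact hvX
        · exact ⟨y, hr y, hyD, fun h => h.elim hyS hyM⟩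
      · refine ⟨z, hyz, hz, ?_⟩
        rintro (h | h)
        · exact hST z h y hyD (hs hyz)
        · exact hyD ((hME h).1 y (hs hyz))

theorem aux_glb {U : Type u} (R : U → U → Prop) (hR : Tolerance R) (hC : CondC R)
    (S : Set ↥(RSpairs R)) : ∃ a, IsGLB S a := by
  have hX : ∀ p : S, ∃ X : Set U, (p : RSpairs R).1 = (lowerApprox R X, upperApprox R X) :=
    fun p => p.1.2
  choose X hX using hX
  obtain ⟨Z, hZ1, hZ2⟩ := aux_key_s16 R hR hC S X
  refine ⟨⟨(lowerApprox R Z, upperApprox R Z), Z, rfl⟩, ?_, ?_⟩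
  · intro p hp
    change (lowerApprox R Z, upperApprox R Z) ≤ p.1
    rw [hX ⟨p, hp⟩, hZ1, hZ2]
    refine ⟨iInter_subset _ (⟨p, hp⟩ : S), ?_⟩
    rintro y ⟨z, hyz, hz⟩
    exact mem_iInter.1 (hz (hR.2 hyz)) ⟨p, hp⟩
  · rintro ⟨_, W, rfl⟩ hW
    change (lowerApprox R W, upperApprox R W) ≤ (lowerApprox R Z, upperApprox R Z)
    have h : ∀ p : S, (lowerApprox R W, upperApprox R W) ≤
        (lowerApprox R (X p), upperApprox R (X p)) := by
      intro p
      rw [← hX p]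
      exact hW p.2
    rw [hZ1, hZ2]
    refine ⟨subset_iInter fun p => (h p).1, ?_⟩
    rintro y ⟨w, hyw, hw⟩
    refine ⟨w, hyw, fun v hv => mem_iInter.2 fun p => (h p).2 ⟨w, hR.2 hv, hw⟩⟩

theorem stmt_16 {U : Type u} (R : U → U → Prop) (hR : Tolerance R) (hC : CondC R) :
    (∀ S : Set ↥(RSpairs R), (∃ a, IsLUB S a) ∧ (∃ a, IsGLB S a)) ∧
    ∀ (ι : Type u) (X : ι → Set U), ∃ Z : Set U,
      lowerApprox R Z = ⋂ i, lowerApprox R (X i) ∧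
      upperApprox R Z = upperApprox R (lowerApprox R (⋂ i, upperApprox R (X i))) := by
  refine ⟨fun S => ⟨?_, aux_glb R hR hC S⟩, aux_key_s16 R hR hC⟩
  obtain ⟨a, ha⟩ := aux_glb R hR hC (upperBounds S)
  exact ⟨a, isGLB_upperBounds.1 ha⟩
end

section
/- Let R be a tolerance on a set U. Then R satisfies condition (C) (for any R-path (a₀, a₁, a₂, a₃, a₄) of length 4 there exist 0 ≤ i, j ≤ 4 with |i − j| ≥ 2 and a_i R a_j) if and only if for every X ⊆ U the relation (R_X)³ is an equivalence relation on X, where R_X is the restriction of R to X and (R_X)³ = R_X ∘ R_X ∘ R_X is its threefold relational composition. -/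
open Set

universe u v

theorem walk4_aux {U : Type*} (R : U → U → Prop) (hr : ∀ x, R x x) (hs : ∀ x y, R x y → R y x)
    (hC : CondC R) (a b c d e : U) (h1 : R a b) (h2 : R b c) (h3 : R c d) (h4 : R d e) :
    ∃ x y, R a x ∧ R x y ∧ R y e := by
  by_contra hn
  have key : ∀ x y, R a x → R x y → R y e → False := fun x y p q r => hn ⟨x, y, p, q, r⟩
  have n02 : ¬ R a c := fun h => key c d h h3 h4
  have n03 : ¬ R a d := fun h => key d d h (hr d) h4
  have n04 : ¬ R a e := fun h => key e e h (hr e) (hr e)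
  have n13 : ¬ R b d := fun h => key b d h1 h h4
  have n14 : ¬ R b e := fun h => key b b h1 (hr b) h
  have n24 : ¬ R c e := fun h => key b c h1 h2 h
  have hinj : Function.Injective ![a, b, c, d, e] := by
    intro i j hij
    fin_cases i <;> fin_cases j <;> first | rfl | (exfalso; simp at hij; subst hij; simp_all)
  obtain ⟨i, j, hij, hRij⟩ := hC ![a, b, c, d, e] hinj (by
    intro i
    fin_cases i <;> simpa)
  fin_cases i <;> fin_cases j <;> simp at hij hRij <;>
    first | contradiction | (have := hs _ _ hRij; contradiction)

theorem equiv_aux {U : Type*} (R : U → U → Prop) (hr : ∀ x, R x x) (hs : ∀ x y, R x y → R y x)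
    (hC : CondC R) : Equivalence (Relation.Comp (Relation.Comp R R) R) := by
  refine ⟨fun x => ⟨x, ⟨x, hr x, hr x⟩, hr x⟩, ?_, ?_⟩
  · rintro x y ⟨p, ⟨q, h1, h2⟩, h3⟩
    exact ⟨q, ⟨p, hs _ _ h3, hs _ _ h2⟩, hs _ _ h1⟩
  · rintro x y z ⟨p, ⟨q, h1, h2⟩, h3⟩ ⟨r, ⟨s, h4, h5⟩, h6⟩
    obtain ⟨u, v, k1, k2, k3⟩ := walk4_aux R hr hs hC _ _ _ _ _ h1 h2 h3 h4
    obtain ⟨u', v', l1, l2, l3⟩ := walk4_aux R hr hs hC _ _ _ _ _ k1 k2 k3 h5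
    obtain ⟨u'', v'', m1, m2, m3⟩ := walk4_aux R hr hs hC _ _ _ _ _ l1 l2 l3 h6
    exact ⟨v'', ⟨u'', m1, m2⟩, m3⟩

theorem stmt_17 {U : Type*} (R : U → U → Prop) (hR : Tolerance R) :
    CondC R ↔ ∀ X : Set U,
      Equivalence
        (Relation.Comp (Relation.Comp (restrictRel R X) (restrictRel R X)) (restrictRel R X)) := by
  obtain ⟨hr, hs⟩ := hR
  constructor
  · intro hC X
    refine equiv_aux _ (fun x => hr x) (fun x y h => hs h) ?_
    intro a ha hp
    exact hC (fun i => (a i : U)) (Subtype.val_injective.comp ha) hp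
  · intro h a _ hp
    by_contra hn
    have key : ∀ i j : Fin 5, ((i : ℕ) + 2 ≤ (j : ℕ) ∨ (j : ℕ) + 2 ≤ (i : ℕ)) → ¬ R (a i) (a j) :=
      fun i j hij hh => hn ⟨i, j, hij, hh⟩
    let f : Fin 5 → Set.range a := fun i => ⟨a i, i, rfl⟩
    have t := (h (Set.range a)).trans (x := f 0) (y := f 3) (z := f 4)
      ⟨f 2, ⟨f 1, hp 0, hp 1⟩, hp 2⟩ ⟨f 3, ⟨f 3, hr _, hr _⟩, hp 3⟩
    obtain ⟨⟨_, j, rfl⟩, ⟨⟨_, i, rfl⟩, h1, h2⟩, h3⟩ := t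
    have e1 := fun hh => key 0 i hh h1
    have e2 := fun hh => key i j hh h2
    have e3 := fun hh => key j 4 hh h3
    simp at e1 e2 e3
    omega
end

section
/- Let R be a tolerance on a set U. The following are equivalent: (a) for every X ⊆ U, the ordered set RS_X of rough sets determined by the restriction R_X of R to X is a complete lattice; (b) for every X ⊆ U with |X| = 5, the ordered set RS_X is a lattice; (c) for every X ⊆ U, the relation (R_X)³ is an equivalence relation on X. -/
open Set

universe u v

def P5Free {V : Type*} (R : V → V → Prop) : Prop :=
  ∀ a b c d e : V, R a b → R b c → R c d → R d e →
    ¬ R a c → ¬ R a d → ¬ R a e → ¬ R b d → ¬ R b e → ¬ R c e → False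

theorem exists_maximal_indep {V : Type*} (R : V → V → Prop) (hs : Symmetric R) (Q : Set V) :
    ∃ M ⊆ Q, (∀ x ∈ M, ∀ y ∈ M, R x y → x = y) ∧ ∀ x ∈ Q, x ∉ M → ∃ y ∈ M, R x y := by
  obtain ⟨M, hM⟩ := zorn_subset {M : Set V | M ⊆ Q ∧ ∀ x ∈ M, ∀ y ∈ M, R x y → x = y} (by
    intro c hc hch
    refine ⟨⋃₀ c, ⟨sUnion_subset fun t ht => (hc ht).1, ?_⟩, fun t ht => subset_sUnion_of_mem ht⟩
    rintro x ⟨s, hs', hx⟩ y ⟨t, ht, hy⟩ hxy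
    rcases hch.total hs' ht with h | h
    · exact (hc ht).2 x (h hx) y hy hxy
    · exact (hc hs').2 x hx y (h hy) hxy)
  refine ⟨M, hM.prop.1, hM.prop.2, fun x hxQ hxM => ?_⟩
  by_contra hcon
  push Not at hcon
  apply hxM
  refine hM.le_of_ge (y := insert x M) ⟨insert_subset hxQ hM.prop.1, ?_⟩
    (subset_insert x M) (mem_insert x M)
  rintro y (rfl | hy) z (rfl | hz) hyz
  · rfl
  · exact absurd hyz (hcon z hz)
  · exact absurd (hs hyz) (hcon y hy)
  · exact hM.prop.2 y hy z hz hyz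

theorem exists_join_set {V : Type*} (R : V → V → Prop) (hR : Tolerance R) (h5 : P5Free R)
    (A D : Set V) (hDA : D ⊆ A) (hD : ∀ x ∈ D, ∃ w, R w x ∧ ∀ v, R w v → v ∈ D)
    (hiso : ∀ x ∈ A, (∀ y, R x y → y = x) → x ∈ D) :
    ∃ Y, D ⊆ Y ∧ lowerApprox R Y ⊆ lowerApprox R D ∧ upperApprox R Y = upperApprox R A := by
  obtain ⟨hr, hs⟩ := hR
  -- C is the closure of A
  let C : Set V := {x | ∀ y, R x y → ∃ a ∈ A, R y a}
  have hAC : A ⊆ C := fun x hx y hxy => ⟨x, hx, hs hxy⟩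
  -- exterior points forcing a member of Y
  let P1 : Set V := {y | y ∉ C ∧ (∃ a ∈ A, R y a) ∧ ∀ d ∈ D, ¬ R y d}
  let r : Set V := {x | x ∈ C ∧ x ∉ D ∧ (∃ d ∈ D, R x d) ∧ ∀ y ∈ P1, ¬ R x y}
  let Q : Set V := {x | x ∈ C ∧ x ∉ D ∧ (∀ d ∈ D, ¬ R x d) ∧ (∀ y, R x y → y ∈ C) ∧
    ∀ y ∈ r, ¬ R x y}
  obtain ⟨M, hMQ, hMi, hMm⟩ := exists_maximal_indep R hs Q
  have hDY : D ⊆ {x | x ∈ C ∧ x ∉ r ∧ x ∉ M} := fun x hx =>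
    ⟨hAC (hDA hx), fun h => h.2.1 hx, fun h => (hMQ h).2.1 hx⟩
  refine ⟨{x | x ∈ C ∧ x ∉ r ∧ x ∉ M}, hDY, ?_, ?_⟩
  · intro x hx v hxv
    by_contra hv
    have hx' : ∀ y, R x y → y ∈ C ∧ y ∉ r ∧ y ∉ M := fun y hy => hx hy
    by_cases hxD : x ∈ D
    · obtain ⟨w, hwx, hw⟩ := hD x hxD
      obtain ⟨hvC, hvr, hvM⟩ := hx' v hxv
      apply hvr
      refine ⟨hvC, hv, ⟨x, hxD, hs hxv⟩, ?_⟩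
      rintro y ⟨hyC, hyA, hyD⟩ hvy
      have : ∃ z, R y z ∧ ∀ a ∈ A, ¬ R z a := by
        by_contra hcon
        push Not at hcon
        exact hyC hcon
      obtain ⟨z, hyz, hz⟩ := this
      refine h5 w x v y z hwx hxv hvy hyz ?_ ?_ ?_ ?_ ?_ ?_
      · exact fun h => hv (hw _ h)
      · exact fun h => hyD w (hw _ (hr w)) (hs h)
      · exact fun h => hz w (hDA (hw _ (hr w))) (hs h)
      · exact fun h => hyD x hxD (hs h)
      · exact fun h => hz x (hDA hxD) (hs h)
      · intro h
        obtain ⟨a, ha, hza⟩ := hvC z h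
        exact hz a ha hza
    · obtain ⟨hxC, hxr, hxM⟩ := hx' x (hr x)
      by_cases hd : ∃ d ∈ D, R x d
      · exact hxr ⟨hxC, hxD, hd, fun y hy hxy => hy.1 (hx' y hxy).1⟩
      · push Not at hd
        have hxQ : x ∈ Q := ⟨hxC, hxD, hd, fun y hy => (hx' y hy).1,
          fun y hy hxy => (hx' y hxy).2.1 hy⟩
        obtain ⟨y, hyM, hxy⟩ := hMm x hxQ hxM
        exact (hx' y hxy).2.2 hyM
  · apply Subset.antisymm
    · rintro x ⟨y, hxy, hyC, -, -⟩
      obtain ⟨a, ha, hxa⟩ := hyC x (hs hxy)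
      exact ⟨a, hxa, ha⟩
    · rintro x ⟨a, hxa, haA⟩
      have hxa : R x a := hxa
      by_contra hcon
      have hx : ∀ y, R x y → ¬ (y ∈ C ∧ y ∉ r ∧ y ∉ M) := fun y hy h => hcon ⟨y, hy, h⟩
      have hxD : ∀ d ∈ D, ¬ R x d := fun d hd h => hx d h (hDY hd)
      by_cases hxC : x ∈ C
      · have hxr : x ∉ r := fun ⟨_, _, ⟨d, hd, h⟩, _⟩ => hxD d hd h
        have hxM : x ∈ M := by
          by_contra h
          exact hx x (hr x) ⟨hxC, hxr, h⟩
        have hxQ := hMQ hxM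
        have hall : ∀ y, R x y → y = x := by
          intro y hy
          have h1 := hx y hy
          have h2 := hxQ.2.2.2.1 y hy
          have h3 : y ∉ r := fun h => hxQ.2.2.2.2 y h hy
          have h4 : y ∈ M := by
            by_contra h
            exact h1 ⟨h2, h3, h⟩
          exact (hMi x hxM y h4 hy).symm
        exact hxQ.2.1 (hiso x (by rw [← hall a hxa]; exact haA) hall)
      · refine hx a hxa ⟨hAC haA, ?_, ?_⟩
        · exact fun h => h.2.2.2 x ⟨hxC, ⟨a, haA, hxa⟩, hxD⟩ (hs hxa)
        · exact fun h => hxC ((hMQ h).2.2.2.1 x (hs hxa))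

theorem exists_lub_of_P5Free {V : Type*} (R : V → V → Prop) (hR : Tolerance R) (h5 : P5Free R)
    (S : Set ↥(RSpairs R)) : ∃ a, IsLUB S a := by
  let I : Set (Set V) := {T | ∃ s ∈ S, s.1 = (lowerApprox R T, upperApprox R T)}
  obtain ⟨Y, hDY, hYl, hYu⟩ := exists_join_set R hR h5 {x | ∃ T ∈ I, x ∈ T}
    {x | ∃ T ∈ I, ∃ w ∈ lowerApprox R T, R w x}
    (by
      rintro x ⟨T, hT, w, hw, hwx⟩
      exact ⟨T, hT, hw hwx⟩)
    (by
      rintro x ⟨T, hT, w, hw, hwx⟩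
      exact ⟨w, hwx, fun v hv => ⟨T, hT, w, hw, hv⟩⟩)
    (by
      rintro x ⟨T, hT, hx⟩ hall
      refine ⟨T, hT, x, ?_, hR.1 x⟩
      intro y hy
      rw [hall y hy]
      exact hx)
  refine ⟨⟨(lowerApprox R Y, upperApprox R Y), Y, rfl⟩, ?_, ?_⟩
  · rintro ⟨_, T, rfl⟩ hs
    have hT : T ∈ I := ⟨_, hs, rfl⟩
    refine ⟨?_, ?_⟩
    · intro w hw v hv
      exact hDY ⟨T, hT, w, hw, hv⟩
    · change upperApprox R T ⊆ upperApprox R Y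
      rw [hYu]
      rintro x ⟨y, hxy, hy⟩
      exact ⟨y, hxy, T, hT, hy⟩
  · rintro ⟨_, Z, rfl⟩ hZ
    refine ⟨?_, ?_⟩
    · intro x hx v hv
      obtain ⟨T, ⟨s, hs, hsT⟩, w, hw, hwv⟩ := hYl hx hv
      have := (hZ hs).1
      rw [hsT] at this
      exact this hw hwv
    · change upperApprox R Y ⊆ upperApprox R Z
      rw [hYu]
      rintro x ⟨y, hxy, T, ⟨s, hs, hsT⟩, hy⟩
      have := (hZ hs).2
      rw [hsT] at this
      exact this ⟨y, hxy, hy⟩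

theorem P5Free_of_lub {U : Type*} (R : U → U → Prop) (hR : Tolerance R)
    (h : ∀ X : Set U, X.ncard = 5 → ∀ p q : ↥(RSpairs (restrictRel R X)),
            (∃ s, IsLUB {p, q} s)) : P5Free R := by
  obtain ⟨hr, hs⟩ := hR
  intro a b c d e hab hbc hcd hde nac nad nae nbd nbe nce
  have hcard : ({a, b, c, d, e} : Set U).ncard = 5 := by
    classical
    have h1 : a ≠ b := by rintro rfl; exact nac hbc
    have h2 : a ≠ c := by rintro rfl; exact nac (hr _)
    have h3 : a ≠ d := by rintro rfl; exact nad (hr _)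
    have h4 : a ≠ e := by rintro rfl; exact nae (hr _)
    have h5 : b ≠ c := by rintro rfl; exact nac hab
    have h6 : b ≠ d := by rintro rfl; exact nbd (hr _)
    have h7 : b ≠ e := by rintro rfl; exact nbe (hr _)
    have h8 : c ≠ d := by rintro rfl; exact nbd hbc
    have h9 : c ≠ e := by rintro rfl; exact nce (hr _)
    have h10 : d ≠ e := by rintro rfl; exact nce hcd
    have : ({a, b, c, d, e} : Set U) = (({a, b, c, d, e} : Finset U) : Set U) := by simp
    rw [this, Set.ncard_coe_finset]
    simp [*]
  set X : Set U := {a, b, c, d, e} with hX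
  let R' := restrictRel R X
  let mk (T : Set X) : ↥(RSpairs R') := ⟨(lowerApprox R' T, upperApprox R' T), T, rfl⟩
  obtain ⟨⟨_, Z, rfl⟩, hub, hleast⟩ := h X hcard (mk {x | x.1 = a ∨ x.1 = b}) (mk {x | x.1 = c})
  have hmem : ∀ x : X, x.1 = a ∨ x.1 = b ∨ x.1 = c ∨ x.1 = d ∨ x.1 = e := fun x => x.2
  let a' : X := ⟨a, by simp [hX]⟩
  let b' : X := ⟨b, by simp [hX]⟩
  let c' : X := ⟨c, by simp [hX]⟩
  let d' : X := ⟨d, by simp [hX]⟩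
  let e' : X := ⟨e, by simp [hX]⟩
  have hp := hub (mem_insert _ _)
  have hq := hub (mem_insert_of_mem _ rfl)
  -- first upper bound
  have u1 := @hleast (mk {x | x.1 = a ∨ x.1 = b ∨ x.1 = c}) (by
    rintro _ (rfl | rfl)
    · refine ⟨fun x hx y hy => ?_, ?_⟩
      · rcases hx hy with h | h
        · exact Or.inl h
        · exact Or.inr (Or.inl h)
      · rintro x ⟨y, hy, h | h⟩
        · exact ⟨y, hy, Or.inl h⟩
        · exact ⟨y, hy, Or.inr (Or.inl h)⟩
    · refine ⟨fun x hx y hy => Or.inr (Or.inr (hx hy)), ?_⟩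
      rintro x ⟨y, hy, h⟩
      exact ⟨y, hy, Or.inr (Or.inr h)⟩)
  have u2 := @hleast (mk {x | x.1 ≠ c}) (by
    have hup : ∀ x : X, x ∈ upperApprox R' {x | x.1 ≠ c} := by
      intro x
      by_cases hx : x.1 = c
      · refine ⟨b', ?_, ?_⟩
        · change R x.1 b
          rw [hx]; exact hs hbc
        · change b ≠ c
          rintro rfl; exact nac hab
      · exact ⟨x, hr _, hx⟩
    rintro _ (rfl | rfl)
    · refine ⟨fun x hx y hy => ?_, fun x _ => hup x⟩
      change y.1 ≠ c
      rcases hx hy with h | h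
      · rw [h]; rintro rfl; exact nac (hr _)
      · rw [h]; rintro rfl; exact nac hab
    · refine ⟨fun x hx y hy => ?_, fun x _ => hup x⟩
      exfalso
      have h0 : x.1 = c := hx (hr x.1)
      have h1 : b = c := @hx b' (by change R x.1 b; rw [h0]; exact hs hbc)
      rw [h1] at hab
      exact nac hab)
  have hea : e' ∉ upperApprox R' Z := by
    intro h
    obtain ⟨y, hy, h | h | h⟩ := u1.2 h
    · exact nae (hs (h ▸ hy : R e a))
    · exact nbe (hs (h ▸ hy : R e b))
    · exact nce (hs (h ▸ hy : R e c))
  have hdZ : d' ∉ Z := fun h => hea ⟨d', hs hde, h⟩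
  have heZ : e' ∉ Z := fun h => hea ⟨e', hr _, h⟩
  have hcZ : c' ∈ Z := by
    obtain ⟨y, hy, hyZ⟩ := hq.2 (show d' ∈ upperApprox R' {x | x.1 = c} from ⟨c', hs hcd, rfl⟩)
    have hy : R d y.1 := hy
    obtain ⟨y, hyX⟩ := y
    rcases hmem ⟨y, hyX⟩ with h | h | h | h | h <;> simp only at h <;> subst h
    · exact absurd (hs hy) nad
    · exact absurd (hs hy) nbd
    · exact hyZ
    · exact absurd hyZ hdZ
    · exact absurd hyZ heZ
  have haZ : a' ∈ lowerApprox R' Z := by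
    apply hp.1
    intro y hy
    have hy : R a y.1 := hy
    rcases hmem y with h | h | h | h | h
    · exact Or.inl h
    · exact Or.inr h
    · rw [h] at hy; exact absurd hy nac
    · rw [h] at hy; exact absurd hy nad
    · rw [h] at hy; exact absurd hy nae
  have hbZ : b' ∈ lowerApprox R' Z := by
    intro y hy
    have hy : R b y.1 := hy
    obtain ⟨y, hyX⟩ := y
    rcases hmem ⟨y, hyX⟩ with h | h | h | h | h <;> simp only at h <;> subst h
    · exact haZ (hr _)
    · exact haZ hab
    · exact hcZ
    · exact absurd hy nbd
    · exact absurd hy nbe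
  have := u2.1 hbZ
  exact (@this c' hbc) rfl

theorem P5Free.restrict {U : Type*} {R : U → U → Prop} (h : P5Free R) (X : Set U) :
    P5Free (restrictRel R X) :=
  fun a b c d e => h a b c d e

theorem Tolerance.restrict {U : Type*} {R : U → U → Prop} (h : Tolerance R) (X : Set U) :
    Tolerance (restrictRel R X) :=
  ⟨fun a => h.1 a, fun _ _ hab => h.2 hab⟩

theorem equiv_of_P5Free {V : Type*} (R : V → V → Prop) (hR : Tolerance R) (h5 : P5Free R) :
    Equivalence (Relation.Comp (Relation.Comp R R) R) := by
  obtain ⟨hr, hs⟩ := hR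
  have step : ∀ x y z, Relation.Comp (Relation.Comp R R) R x y → R y z →
      Relation.Comp (Relation.Comp R R) R x z := by
    rintro a d e ⟨c, ⟨b, hab, hbc⟩, hcd⟩ hde
    by_contra hcon
    have hcon : ∀ p q, R a p → R p q → ¬ R q e := fun p q h1 h2 h3 => hcon ⟨q, ⟨p, h1, h2⟩, h3⟩
    refine h5 a b c d e hab hbc hcd hde ?_ ?_ ?_ ?_ ?_ ?_
    · exact fun h => hcon c d h hcd hde
    · exact fun h => hcon d d h (hr _) hde
    · exact fun h => hcon e e h (hr _) (hr _)
    · exact fun h => hcon b d hab h hde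
    · exact fun h => hcon b e hab h (hr _)
    · exact fun h => hcon b c hab hbc h
  refine ⟨fun x => ⟨x, ⟨x, hr x, hr x⟩, hr x⟩, ?_, ?_⟩
  · rintro x y ⟨c, ⟨b, h1, h2⟩, h3⟩
    exact ⟨b, ⟨c, hs h3, hs h2⟩, hs h1⟩
  · rintro x y z h ⟨c, ⟨b, h1, h2⟩, h3⟩
    exact step _ _ _ (step _ _ _ (step _ _ _ h h1) h2) h3

theorem P5Free_of_equiv {U : Type*} (R : U → U → Prop) (hR : Tolerance R)
    (h : ∀ X : Set U, Equivalence
            (Relation.Comp (Relation.Comp (restrictRel R X) (restrictRel R X))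
              (restrictRel R X))) : P5Free R := by
  obtain ⟨hr, hs⟩ := hR
  intro a b c d e hab hbc hcd hde nac nad nae nbd nbe nce
  have hX := h {a, b, c, d, e}
  obtain ⟨⟨q, hq⟩, ⟨⟨p, hp⟩, h1, h2⟩, h3⟩ := hX.trans
    (x := ⟨a, by simp⟩) (y := ⟨d, by simp⟩) (z := ⟨e, by simp⟩)
    ⟨⟨c, by simp⟩, ⟨⟨b, by simp⟩, hab, hbc⟩, hcd⟩
    ⟨⟨d, by simp⟩, ⟨⟨d, by simp⟩, hr d, hr d⟩, hde⟩
  have h1 : R a p := h1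
  have h2 : R p q := h2
  have h3 : R q e := h3
  have hp2 : p = a ∨ p = b ∨ p = c ∨ p = d ∨ p = e := hp
  have hq2 : q = a ∨ q = b ∨ q = c ∨ q = d ∨ q = e := hq
  have hp' : p = a ∨ p = b := by
    rcases hp2 with h | h | h | h | h
    · exact Or.inl h
    · exact Or.inr h
    · rw [h] at h1; exact absurd h1 nac
    · rw [h] at h1; exact absurd h1 nad
    · rw [h] at h1; exact absurd h1 nae
  rcases hq2 with h | h | h | h | h
  · rw [h] at h3; exact nae h3
  · rw [h] at h3; exact nbe h3
  · rw [h] at h3; exact nce h3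
  · rw [h] at h2; rcases hp' with h' | h' <;> rw [h'] at h2
    · exact nad h2
    · exact nbd h2
  · rw [h] at h2; rcases hp' with h' | h' <;> rw [h'] at h2
    · exact nae h2
    · exact nbe h2

theorem stmt_18 {U : Type*} (R : U → U → Prop) (hR : Tolerance R) :
    List.TFAE
      [ ∀ X : Set U, ∀ S : Set ↥(RSpairs (restrictRel R X)),
          (∃ a, IsLUB S a) ∧ (∃ a, IsGLB S a),
        ∀ X : Set U, X.ncard = 5 →
          ∀ p q : ↥(RSpairs (restrictRel R X)),
            (∃ s, IsLUB {p, q} s) ∧ (∃ s, IsGLB {p, q} s),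
        ∀ X : Set U,
          Equivalence
            (Relation.Comp (Relation.Comp (restrictRel R X) (restrictRel R X))
              (restrictRel R X)) ] := by
  tfae_have 1 → 2 := fun h X _ p q => h X {p, q}
  tfae_have 2 → 3 := fun h X => by
    have h5 := P5Free_of_lub R hR fun X hX p q => (h X hX p q).1
    exact equiv_of_P5Free _ (hR.restrict X) (h5.restrict X)
  tfae_have 3 → 1 := fun h X S => by
    have h5 := P5Free_of_equiv R hR h
    have key := exists_lub_of_P5Free _ (hR.restrict X) (h5.restrict X)
    refine ⟨key S, ?_⟩
    obtain ⟨a, ha⟩ := key (lowerBounds S)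
    exact ⟨a, isLUB_lowerBounds.1 ha⟩
  tfae_finish
end
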